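/- arXiv:1002.3544 — 8 statements merged into one kernel-verified Lean document; each statement's English description precedes it below -/
import Mathlib

section
/- Let V be a finite nonempty type and w : V → V → ℝ a weight function. If C̄ is an irreducible cycle whose specific energy is minimal among all irreducible cycles, then for every cycle C (of any length n ≥ 1) the specific energy of C is at least the specific energy of C̄; i.e., the irreducible cycle of minimal specific energy has minimal specific energy among all cycles. -/
/-- Total weight of a cycle `f : ZMod n → V` in the complete directed graph on `V`
with edge weights `w`: the sum `∑ i, w (f i) (f (i+1))`. (Zero for `n = 0`.) -/
noncomputable def totalWeight {V : Type*} (w : V → V → ℝ) (n : ℕ) (f : ZMod n → V) : ℝ :=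
  if h : n = 0 then 0 else
    haveI : NeZero n := ⟨h⟩
    ∑ i : ZMod n, w (f i) (f (i + 1))

/-- Specific energy of a cycle: `(1/n)` times its total weight. -/
noncomputable def specificEnergy {V : Type*} (w : V → V → ℝ) (n : ℕ) (f : ZMod n → V) : ℝ :=
  (1 / (n : ℝ)) * totalWeight w n f

/-- The total weight of a cycle of positive length, as a sum over natural number indices. -/
theorem totalWeight_eq_sum_range {V : Type*} (w : V → V → ℝ) (n : ℕ) (hn : 1 ≤ n)
    (f : ZMod n → V) :
    totalWeight w n f = ∑ i ∈ Finset.range n, w (f i) (f ((i + 1 : ℕ) : ZMod n)) := by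
  obtain ⟨k, rfl⟩ : ∃ k, n = k + 1 := ⟨n - 1, by omega⟩
  rw [totalWeight, dif_neg (Nat.succ_ne_zero k), Finset.sum_range]
  change ∑ i : Fin (k + 1), _ = _
  refine Finset.sum_congr rfl fun i _ => ?_
  have hi : ((i : ℕ) : ZMod (k + 1)) = i := Fin.cast_val_eq_self i
  rw [Nat.cast_succ, hi]

/-- A closed walk without repeated vertices has the weight of the corresponding cycle. -/
theorem totalWeight_val_eq_sum_range {V : Type*} (w : V → V → ℝ) (n : ℕ) (hn : 1 ≤ n)
    (u : ℕ → V) (hu : u n = u 0) :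
    totalWeight w n (fun i : ZMod n => u i.val)
      = ∑ i ∈ Finset.range n, w (u i) (u (i + 1)) := by
  rw [totalWeight_eq_sum_range w n hn]
  refine Finset.sum_congr rfl fun i hi => ?_
  have hi' := Finset.mem_range.1 hi
  simp only [ZMod.val_natCast]
  rw [Nat.mod_eq_of_lt hi']
  rcases Nat.lt_or_ge (i + 1) n with h | h
  · rw [Nat.mod_eq_of_lt h]
  · obtain rfl : i + 1 = n := by omega
    rw [Nat.mod_self, hu]

/-- A lower bound on the mean weight of irreducible cycles holds for all closed walks. -/
theorem mul_le_sum_range_of_closed {V : Type*} (w : V → V → ℝ) (c : ℝ)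
    (hc : ∀ k : ℕ, 1 ≤ k → ∀ h : ZMod k → V, Function.Injective h →
      c ≤ specificEnergy w k h) (n : ℕ) (hn : 1 ≤ n) (u : ℕ → V) (hu : u n = u 0) :
    c * n ≤ ∑ i ∈ Finset.range n, w (u i) (u (i + 1)) := by
  induction n using Nat.strong_induction_on generalizing u with
  | _ n ih =>
    by_cases hinj : ∀ a b, a < b → b < n → u a ≠ u b
    · have : NeZero n := ⟨by omega⟩
      have hn' : (0 : ℝ) < n := by exact_mod_cast hn
      have key := hc n hn (fun i : ZMod n => u i.val) fun x y hxy => by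
        apply ZMod.val_injective n
        rcases lt_trichotomy x.val y.val with h | h | h
        · exact absurd hxy (hinj _ _ h (ZMod.val_lt y))
        · exact h
        · exact absurd hxy.symm (hinj _ _ h (ZMod.val_lt x))
      rwa [specificEnergy, totalWeight_val_eq_sum_range w n hn u hu, one_div_mul_eq_div,
        le_div_iff₀ hn'] at key
    · push Not at hinj
      obtain ⟨a, b, hab, hbn, huab⟩ := hinj
      obtain ⟨d, rfl⟩ := Nat.exists_eq_add_of_lt hab
      obtain ⟨e, rfl⟩ := Nat.exists_eq_add_of_lt hbn
      have h₁ := ih (d + 1) (by omega) (by omega) (fun j => u (a + j)) huab.symm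
      have h₂ := ih (a + (e + 1)) (by omega) (by omega)
        (fun j => if j < a then u j else u (j + (d + 1))) (by
          rw [if_neg (by omega), show a + (e + 1) + (d + 1) = a + d + 1 + e + 1 by omega, hu]
          split_ifs with h
          · rfl
          · obtain rfl : a = 0 := by omega
            exact huab)
      have h₃ : ∑ i ∈ Finset.range a, w (if i < a then u i else u (i + (d + 1)))
            (if i + 1 < a then u (i + 1) else u (i + 1 + (d + 1)))
          = ∑ i ∈ Finset.range a, w (u i) (u (i + 1)) := by
        refine Finset.sum_congr rfl fun i hi => ?_
        have hi' := Finset.mem_range.1 hi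
        rw [if_pos hi']
        split_ifs with h
        · rfl
        · obtain rfl : i + 1 = a := by omega
          rw [huab, add_assoc (i + 1)]
      have h₄ : ∑ i ∈ Finset.range (e + 1),
            w (if a + i < a then u (a + i) else u (a + i + (d + 1)))
            (if a + i + 1 < a then u (a + i + 1) else u (a + i + 1 + (d + 1)))
          = ∑ i ∈ Finset.range (e + 1), w (u (a + (d + 1) + i)) (u (a + (d + 1) + i + 1)) := by
        refine Finset.sum_congr rfl fun i _ => ?_
        rw [if_neg (by omega), if_neg (by omega)]
        congr 2 <;> omega
      rw [Finset.sum_range_add, h₃, h₄] at h₂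
      rw [show a + d + 1 + e + 1 = a + (d + 1) + (e + 1) by omega, Finset.sum_range_add,
        Finset.sum_range_add]
      simp only [← add_assoc] at h₁ h₂ ⊢
      push_cast at h₁ h₂ ⊢
      linarith

/-- If an irreducible cycle has minimal specific energy among all irreducible cycles,
then it has minimal specific energy among all cycles. -/
theorem irreducible_min_is_global_min {V : Type*} [Fintype V] [Nonempty V]
    (w : V → V → ℝ) (m : ℕ) (hm : 1 ≤ m) (g : ZMod m → V) (hg : Function.Injective g)
    (hmin : ∀ (k : ℕ), 1 ≤ k → ∀ h : ZMod k → V, Function.Injective h →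
      specificEnergy w m g ≤ specificEnergy w k h) :
    ∀ (n : ℕ), 1 ≤ n → ∀ f : ZMod n → V,
      specificEnergy w m g ≤ specificEnergy w n f := by
  intro n hn f
  have hn' : (0 : ℝ) < n := by exact_mod_cast hn
  have key := mul_le_sum_range_of_closed w _ hmin n hn (fun i => f i) (by simp)
  rw [← totalWeight_eq_sum_range w n hn f] at key
  rwa [specificEnergy.eq_def w n, one_div_mul_eq_div, le_div_iff₀ hn']
end

section
/- Let V be a finite nonempty type. For every n ≥ 1 and every cycle f : ZMod n → V, there exist k ≥ 1 irreducible cycles f_1 : ZMod n_1 → V, …, f_k : ZMod n_k → V with n_1 + ⋯ + n_k = n such that the multiset of directed edges {(f i, f (i+1)) : i ∈ ZMod n} equals the multiset union over j = 1,…,k of {(f_j i, f_j (i+1)) : i ∈ ZMod n_j}. In particular, for any weight function w : V → V → ℝ, the total weight of f equals the sum of the total weights of f_1, …, f_k, and the specific energy of f is the convex combination ∑_j (n_j/n) · h(f_j) of the specific energies of the irreducible cycles. -/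
/-- The multiset of directed edges `(f i, f (i+1))`, `i ∈ ZMod n`, of a cycle. -/
noncomputable def edgeMultiset {V : Type*} (n : ℕ) (f : ZMod n → V) : Multiset (V × V) :=
  if h : n = 0 then 0 else
    haveI : NeZero n := ⟨h⟩
    (Finset.univ : Finset (ZMod n)).val.map (fun i => (f i, f (i + 1)))

/-- The multiset of the first `n` directed edges of the walk `g 0, g 1, g 2, …`. -/
def walkEdges {V : Type*} (n : ℕ) (g : ℕ → V) : Multiset (V × V) :=
  ∑ i ∈ Finset.range n, {(g i, g (i + 1))}

theorem walkEdges_add {V : Type*} (m n : ℕ) (g : ℕ → V) :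
    walkEdges (m + n) g = walkEdges m g + walkEdges n (fun x => g (m + x)) := by
  simp only [walkEdges, Finset.sum_range_add, add_assoc]

theorem walkEdges_congr {V : Type*} {n : ℕ} {g h : ℕ → V} (H : ∀ i ≤ n, g i = h i) :
    walkEdges n g = walkEdges n h := by
  refine Finset.sum_congr rfl fun i hi => ?_
  have hi := Finset.mem_range.mp hi
  rw [H i hi.le, H (i + 1) hi]

theorem ZMod.sum_eq_sum_range {M : Type*} [AddCommMonoid M] (n : ℕ) [NeZero n] (F : ZMod n → M) :
    ∑ x, F x = ∑ i ∈ Finset.range n, F i := by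
  refine Finset.sum_bij' (fun x _ => x.val) (fun i _ => (i : ZMod n)) ?_ ?_ ?_ ?_ ?_
  · exact fun x _ => Finset.mem_range.mpr x.val_lt
  · exact fun _ _ => Finset.mem_univ _
  · exact fun x _ => ZMod.natCast_zmod_val x
  · exact fun i hi => ZMod.val_cast_of_lt (Finset.mem_range.mp hi)
  · exact fun x _ => by rw [ZMod.natCast_zmod_val]

theorem edgeMultiset_eq_walkEdges {V : Type*} {n : ℕ} (hn : n ≠ 0) (f : ZMod n → V) :
    edgeMultiset n f = walkEdges n (fun i => f i) := by
  have : NeZero n := ⟨hn⟩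
  rw [edgeMultiset, dif_neg hn, ← Multiset.sum_map_singleton (Multiset.map _ _), Multiset.map_map]
  exact (ZMod.sum_eq_sum_range n fun x => ({(f x, f (x + 1))} : Multiset (V × V))).trans
    (by simp [walkEdges])

theorem edgeMultiset_comp_val {V : Type*} {n : ℕ} (hn : n ≠ 0) {g : ℕ → V} (hg : g n = g 0) :
    edgeMultiset n (fun x => g x.val) = walkEdges n g := by
  rw [edgeMultiset_eq_walkEdges hn]
  refine walkEdges_congr fun i hi => ?_
  rcases hi.lt_or_eq with h | rfl
  · rw [ZMod.val_cast_of_lt h]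
  · simp [hg]

theorem card_edgeMultiset {V : Type*} (n : ℕ) (f : ZMod n → V) :
    (edgeMultiset n f).card = n := by
  by_cases hn : n = 0
  · simp [edgeMultiset, hn]
  · simp [edgeMultiset_eq_walkEdges hn, walkEdges]

theorem totalWeight_eq_sum_edgeMultiset {V : Type*} (w : V → V → ℝ) (n : ℕ) (f : ZMod n → V) :
    totalWeight w n f = ((edgeMultiset n f).map fun e => w e.1 e.2).sum := by
  by_cases hn : n = 0
  · simp [totalWeight, edgeMultiset, hn]
  · rw [totalWeight, edgeMultiset, dif_neg hn, dif_neg hn, Multiset.map_map]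
    rfl

/-- The edges of a closed walk split at a repeated vertex into those of two closed walks. -/
theorem exists_walkEdges_split {V : Type*} {i d r : ℕ} {g : ℕ → V}
    (hg : g (i + d + r) = g 0) (hi : g (i + d) = g i) :
    ∃ h : ℕ → V, h (i + r) = h 0 ∧
      walkEdges (i + d + r) g = walkEdges d (fun x => g (i + x)) + walkEdges (i + r) h := by
  have h_lt : ∀ m ≤ i, (if m < i then g m else g (m + d)) = g m := by
    intro m hm
    split_ifs with h
    · rfl
    · rw [show m = i by omega, hi]
  refine ⟨fun m => if m < i then g m else g (m + d), ?_, ?_⟩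
  · simp only
    rw [h_lt 0 (Nat.zero_le i), if_neg (by omega), ← hg]
    congr 1
    omega
  · rw [walkEdges_add, walkEdges_add, walkEdges_add i r, walkEdges_congr h_lt,
      add_left_comm, ← add_assoc]
    congr 1
    refine walkEdges_congr fun x _ => ?_
    rw [if_neg (by omega)]
    congr 1
    omega

theorem exists_list_injective_cycles {V : Type*} (n : ℕ) (hn : n ≠ 0) (g : ℕ → V)
    (hg : g n = g 0) :
    ∃ L : List (Σ m : ℕ, ZMod m → V),
      (∀ c ∈ L, 1 ≤ c.1 ∧ Function.Injective c.2) ∧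
      walkEdges n g = (L.map fun c => edgeMultiset c.1 c.2).sum := by
  induction n using Nat.strong_induction_on generalizing g with
  | _ n ih =>
  by_cases hinj : Function.Injective fun x : ZMod n => g x.val
  · refine ⟨[⟨n, fun x => g x.val⟩], ?_, ?_⟩
    · simpa using ⟨Nat.one_le_iff_ne_zero.mpr hn, hinj⟩
    · simp [edgeMultiset_comp_val hn hg]
  · have : NeZero n := ⟨hn⟩
    obtain ⟨i, j, hij, hjn, hgij⟩ : ∃ i j, i < j ∧ j < n ∧ g j = g i := by
      simp only [Function.Injective, not_forall] at hinj
      obtain ⟨x, y, hxy, hne⟩ := hinj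
      rcases Nat.lt_or_gt_of_ne (fun h => hne (ZMod.val_injective n h)) with h | h
      · exact ⟨_, _, h, y.val_lt, hxy.symm⟩
      · exact ⟨_, _, h, x.val_lt, hxy⟩
    obtain ⟨d, rfl⟩ := Nat.exists_eq_add_of_le hij.le
    obtain ⟨r, rfl⟩ := Nat.exists_eq_add_of_le hjn.le
    obtain ⟨h, hh, hsplit⟩ := exists_walkEdges_split hg hgij
    obtain ⟨L₁, hL₁, hs₁⟩ := ih d (by omega) (by omega) (fun x => g (i + x)) hgij
    obtain ⟨L₂, hL₂, hs₂⟩ := ih (i + r) (by omega) (by omega) h hh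
    refine ⟨L₁ ++ L₂, fun c hc => ?_, ?_⟩
    · exact (List.mem_append.mp hc).elim (hL₁ c) (hL₂ c)
    · rw [hsplit, hs₁, hs₂, List.map_append, List.sum_append]

/-- Every cycle decomposes into irreducible cycles: the edge multisets add up, the lengths
add up, and hence total weights add up and the specific energy of the cycle is the convex
combination of the specific energies of the irreducible pieces. -/
theorem cycle_decomposition_into_irreducibles {V : Type*} [Fintype V] [Nonempty V]
    (n : ℕ) (hn : 1 ≤ n) (f : ZMod n → V) :
    ∃ (k : ℕ) (_ : 1 ≤ k) (ns : Fin k → ℕ) (fs : ∀ j : Fin k, ZMod (ns j) → V),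
      (∀ j, 1 ≤ ns j) ∧
      (∀ j, Function.Injective (fs j)) ∧
      (∑ j, ns j) = n ∧
      edgeMultiset n f = ∑ j, edgeMultiset (ns j) (fs j) ∧
      (∀ w : V → V → ℝ,
        totalWeight w n f = ∑ j, totalWeight w (ns j) (fs j) ∧
        specificEnergy w n f
          = ∑ j, ((ns j : ℝ) / (n : ℝ)) * specificEnergy w (ns j) (fs j)) := by
  have hn0 : n ≠ 0 := Nat.one_le_iff_ne_zero.mp hn
  obtain ⟨L, hL, hsum⟩ := exists_list_injective_cycles n hn0 (fun i => f i) (by simp)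
  have hedge : edgeMultiset n f = ∑ j : Fin L.length, edgeMultiset L[j].1 L[j].2 := by
    rw [edgeMultiset_eq_walkEdges hn0, hsum]
    exact (Fin.sum_univ_fun_getElem L fun c => edgeMultiset c.1 c.2).symm
  have hlen : ∑ j : Fin L.length, L[j].1 = n := by
    have := congrArg Multiset.card hedge
    simpa only [Multiset.card_sum, card_edgeMultiset] using this.symm
  have hweight (w : V → V → ℝ) :
      totalWeight w n f = ∑ j : Fin L.length, totalWeight w L[j].1 L[j].2 := by
    simp only [totalWeight_eq_sum_edgeMultiset, hedge]
    exact map_sum (Multiset.sumAddMonoidHom.comp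
      (Multiset.mapAddMonoidHom fun e : V × V => w e.1 e.2)) _ _
  have hmem (j : Fin L.length) := hL L[j] (List.getElem_mem j.2)
  refine ⟨L.length, ?_, fun j => L[j].1, fun j => L[j].2, fun j => (hmem j).1,
    fun j => (hmem j).2, hlen, hedge, fun w => ⟨hweight w, ?_⟩⟩
  · rw [Nat.one_le_iff_ne_zero]
    intro h
    obtain rfl := List.length_eq_zero_iff.mp h
    exact hn0 (by simpa using hlen.symm)
  · rw [specificEnergy, hweight, Finset.mul_sum]
    refine Finset.sum_congr rfl fun j _ => ?_
    have : (L[j].1 : ℝ) ≠ 0 := Nat.cast_ne_zero.mpr (Nat.one_le_iff_ne_zero.mp (hmem j).1)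
    rw [specificEnergy]
    field_simp
end

section
/- Any one-dimensional lattice model with a finite spin space and a finite-range potential has a periodic ground state. Precisely: let S be a finite nonempty type, R ≥ 1 an integer, and φ : (Fin R → S) → ℝ a potential. Then there exist an integer p ≥ 1 and a configuration a : ℤ → S with a(i + p) = a(i) for all i ∈ ℤ, such that for every configuration s : ℤ → S with {i ∈ ℤ : s(i) ≠ a(i)} finite, the relative Hamiltonian H(s,a) = ∑_{x ∈ ℤ} [φ(j ↦ s(x + j)) − φ(j ↦ a(x + j))] (a sum with only finitely many nonzero terms) satisfies H(s,a) ≥ 0. -/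
/-- The first `m` steps of `w` follow the relation `T` and return to the starting vertex. -/
def IsClosedWalk {V : Type*} (T : V → V → Prop) (w : ℕ → V) (m : ℕ) : Prop :=
  w m = w 0 ∧ ∀ i < m, T (w i) (w (i + 1))

namespace IsClosedWalk

variable {V : Type*} {T : V → V → Prop} {w : ℕ → V}

/-- The part of a walk between two visits to the same vertex is closed. -/
lemma segment {i d r : ℕ} (h : IsClosedWalk T w (i + d + r)) (hw : w (i + d) = w i) :
    IsClosedWalk T (fun t => w (i + t)) d :=
  ⟨by simpa using hw, fun t ht => h.2 (i + t) (by omega)⟩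

/-- Removing the part of a closed walk between two visits to the same vertex leaves a
closed walk. -/
lemma excise {i d r : ℕ} (h : IsClosedWalk T w (i + d + r)) (hw : w (i + d) = w i) :
    IsClosedWalk T (fun t => if t < i then w t else w (t + d)) (i + r) := by
  refine ⟨?_, fun t ht => ?_⟩
  · have h1 : w (i + r + d) = w 0 := by rw [← h.1]; congr 1; omega
    rcases Nat.eq_zero_or_pos i with rfl | hi
    · simp only [not_lt_zero, if_false, h1]
      exact hw.symm
    · simp [hi, h1]
  · rcases lt_trichotomy (t + 1) i with hti | hti | hti
    · simpa [hti, show t < i by omega] using h.2 t (by omega)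
    · have h1 := h.2 t (by omega)
      subst hti
      simpa [hw] using h1
    · have h1 := h.2 (t + d) (by omega)
      simpa [show ¬ t < i by omega, show ¬ t + 1 < i by omega,
        show t + 1 + d = t + d + 1 by omega] using h1

end IsClosedWalk

lemma sum_range_excise {V : Type*} (f : V → ℝ) (w : ℕ → V) (i d r : ℕ) :
    ∑ t ∈ Finset.range (i + d + r), f (w t) =
      ∑ t ∈ Finset.range d, f (w (i + t)) +
        ∑ t ∈ Finset.range (i + r), f (if t < i then w t else w (t + d)) := by
  have h : ∑ t ∈ Finset.range i, f (if t < i then w t else w (t + d)) =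
      ∑ t ∈ Finset.range i, f (w t) :=
    Finset.sum_congr rfl fun t ht => by rw [if_pos (Finset.mem_range.1 ht)]
  have h' : ∑ t ∈ Finset.range r, f (w (i + d + t)) =
      ∑ t ∈ Finset.range r, f (w (i + t + d)) :=
    Finset.sum_congr rfl fun t _ => by rw [add_right_comm]
  rw [Finset.sum_range_add, Finset.sum_range_add, Finset.sum_range_add, h, h']
  simp only [add_lt_iff_neg_left, not_lt_zero, if_false]
  ring

/-- If every closed walk of length at most the number of vertices has mean weight at least `e`,
then so does every closed walk. -/
lemma IsClosedWalk.mul_le_sum {V : Type*} [Fintype V] {T : V → V → Prop} {f : V → ℝ} {e : ℝ}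
    (he : ∀ m w, 1 ≤ m → m ≤ Fintype.card V → IsClosedWalk T w m →
      m * e ≤ ∑ t ∈ Finset.range m, f (w t)) :
    ∀ m w, IsClosedWalk T w m → m * e ≤ ∑ t ∈ Finset.range m, f (w t) := by
  intro m
  induction m using Nat.strong_induction_on with
  | _ m ih =>
    intro w hw
    rcases Nat.eq_zero_or_pos m with rfl | hm
    · simp
    rcases le_or_gt m (Fintype.card V) with hmV | hmV
    · exact he m w hm hmV hw
    obtain ⟨i, j, hij, hwij⟩ : ∃ i j : Fin m, i < j ∧ w i = w j := by
      obtain ⟨i, j, hne, h⟩ := Fintype.exists_ne_map_eq_of_card_lt (fun i : Fin m => w i)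
        (by simpa using hmV)
      rcases lt_or_gt_of_ne hne with hlt | hlt
      · exact ⟨i, j, hlt, h⟩
      · exact ⟨j, i, hlt, h.symm⟩
    obtain ⟨d, hd⟩ := Nat.exists_eq_add_of_lt (Fin.lt_def.1 hij)
    obtain ⟨r, hr⟩ := Nat.exists_eq_add_of_lt j.2
    obtain ⟨i, hi⟩ := i
    obtain ⟨j, hj⟩ := j
    simp only at hd hr hwij
    obtain rfl : j = i + (d + 1) := by omega
    obtain rfl : m = i + (d + 1) + (r + 1) := by omega
    have h1 := ih (d + 1) (by omega) _ (hw.segment hwij.symm)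
    have h2 := ih (i + (r + 1)) (by omega) _ (hw.excise hwij.symm)
    rw [sum_range_excise]
    push_cast at h1 h2 ⊢
    linarith

/-- A finite directed graph with a loop has a closed walk of minimal mean weight. -/
lemma exists_isClosedWalk_minimal_mean {V : Type*} [Fintype V] (T : V → V → Prop) (f : V → ℝ)
    {v : V} (hv : T v v) :
    ∃ p w, 1 ≤ p ∧ IsClosedWalk T w p ∧ ∀ m w', IsClosedWalk T w' m →
      m * ((∑ t ∈ Finset.range p, f (w t)) / p) ≤ ∑ t ∈ Finset.range m, f (w' t) := by
  classical
  let A : Set ℝ := {e | ∃ m w, 1 ≤ m ∧ m ≤ Fintype.card V ∧ IsClosedWalk T w m ∧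
    e = (∑ t ∈ Finset.range m, f (w t)) / m}
  have hfin : A.Finite := by
    refine (Set.finite_range
      (fun x : Σ m : Fin (Fintype.card V + 1), (Fin m → V) =>
        (∑ t, f (x.2 t)) / ((x.1 : ℕ) : ℝ))).subset ?_
    rintro _ ⟨m, w, -, hm, -, rfl⟩
    refine ⟨⟨⟨m, by omega⟩, fun t => w t⟩, ?_⟩
    simp only [Finset.sum_range]
  have hne : A.Nonempty :=
    ⟨_, 1, fun _ => v, le_rfl, Fintype.card_pos_iff.2 ⟨v⟩, ⟨rfl, fun _ _ => hv⟩, rfl⟩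
  obtain ⟨e, ⟨p, w, hp, -, hw, rfl⟩, hmin⟩ := Set.exists_min_image A id hfin hne
  refine ⟨p, w, hp, hw, IsClosedWalk.mul_le_sum fun m w' hm hmV hw' => ?_⟩
  have h := hmin _ ⟨m, w', hm, hmV, hw', rfl⟩
  have hm' : (0 : ℝ) < m := by exact_mod_cast hm
  rw [id, id, le_div_iff₀ hm'] at h
  linarith

lemma sum_range_mul_mod (g : ℕ → ℝ) (p q : ℕ) :
    ∑ t ∈ Finset.range (q * p), g (t % p) = q * ∑ t ∈ Finset.range p, g t := by
  induction q with
  | zero => simp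
  | succ q ih =>
    have h : ∑ t ∈ Finset.range p, g (t % p) = ∑ t ∈ Finset.range p, g t :=
      Finset.sum_congr rfl fun t ht => by rw [Nat.mod_eq_of_lt (Finset.mem_range.1 ht)]
    simp only [Nat.succ_mul, Finset.sum_range_add, ih, Nat.mul_add_mod_self_right, h]
    push_cast
    ring

lemma sum_Ico_int_eq_sum_range (g : ℤ → ℝ) (c : ℤ) (m : ℕ) :
    ∑ x ∈ Finset.Ico c (c + m), g x = ∑ t ∈ Finset.range m, g (c + t) := by
  symm
  refine Finset.sum_bij (fun t _ => c + (t : ℤ)) ?_ ?_ ?_ ?_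
  · intro t ht
    simp only [Finset.mem_range, Finset.mem_Ico] at *
    omega
  · intro t _ t' _ h
    omega
  · intro x hx
    simp only [Finset.mem_Ico] at hx
    exact ⟨(x - c).toNat, by simp only [Finset.mem_range]; omega, by omega⟩
  · intros
    rfl

/-- The window `v` is a shift of the window `u` by one site. -/
def IsShift {S : Type*} {R : ℕ} (u v : Fin R → S) : Prop :=
  ∀ (j : ℕ) (h : j + 1 < R), u ⟨j + 1, h⟩ = v ⟨j, by omega⟩

/-- A closed walk of windows is the sequence of windows of a periodic configuration. -/
lemma IsClosedWalk.exists_configuration {S : Type*} {R : ℕ} (hR : 1 ≤ R) {w : ℕ → Fin R → S}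
    {p : ℕ} (hp : 1 ≤ p) (hw : IsClosedWalk IsShift w p) :
    ∃ a : ℤ → S, (∀ i : ℤ, a (i + p) = a i) ∧
      ∀ x : ℤ, (fun j : Fin R => a (x + (j.val : ℤ))) = w (x % p).toNat := by
  have hp' : (0 : ℤ) < p := by exact_mod_cast hp
  have hstep : ∀ x : ℤ, IsShift (w (x % p).toNat) (w ((x + 1) % p).toNat) := by
    intro x
    have h0 := Int.emod_nonneg x hp'.ne'
    have h1 := Int.emod_lt_of_pos x hp'
    have h2 := hw.2 (x % p).toNat (by omega)
    rw [← Int.emod_add_emod]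
    rcases (show x % p + 1 < p ∨ x % p + 1 = p by omega) with h | h
    · rw [Int.emod_eq_of_lt (by omega) h]
      rwa [show (x % p + 1).toNat = (x % p).toNat + 1 by omega]
    · rw [h, Int.emod_self, Int.toNat_zero, ← hw.1]
      rwa [show (x % p).toNat + 1 = p by omega] at h2
  refine ⟨fun i => w (i % p).toNat ⟨0, hR⟩, fun i => by simp, fun x => ?_⟩
  have key : ∀ (j : ℕ) (hj : j < R) (x : ℤ),
      w ((x + j) % p).toNat ⟨0, hR⟩ = w (x % p).toNat ⟨j, hj⟩ := by
    intro j
    induction j with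
    | zero => simp
    | succ j ih =>
      intro hj x
      rw [hstep x j hj, ← ih (by omega) (x + 1)]
      push_cast
      rw [add_assoc, add_comm (1 : ℤ)]
  exact funext fun j => key j j.2 x

/-- Any one-dimensional lattice model with a finite spin space and a finite-range potential
has a periodic ground state: there are `p ≥ 1` and a `p`-periodic configuration `a : ℤ → S`
such that the relative Hamiltonian `H(s,a)` is nonnegative for every configuration `s`
equal to `a` almost everywhere. -/
theorem exists_periodic_ground_state {S : Type*} [Fintype S] [Nonempty S]
    (R : ℕ) (hR : 1 ≤ R) (φ : (Fin R → S) → ℝ) :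
    ∃ (p : ℕ) (a : ℤ → S), 1 ≤ p ∧ (∀ i : ℤ, a (i + (p : ℤ)) = a i) ∧
      ∀ s : ℤ → S, {i : ℤ | s i ≠ a i}.Finite →
        0 ≤ ∑ᶠ x : ℤ,
          (φ (fun j => s (x + (j.val : ℤ))) - φ (fun j => a (x + (j.val : ℤ)))) := by
  obtain ⟨σ⟩ := ‹Nonempty S›
  obtain ⟨p, w, hp, hw, hmin⟩ := exists_isClosedWalk_minimal_mean IsShift φ
    (v := fun _ : Fin R => σ) (fun _ _ => rfl)
  obtain ⟨a, ha, haw⟩ := hw.exists_configuration hR hp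
  refine ⟨p, a, hp, ha, fun s hs => ?_⟩
  obtain ⟨B, hB⟩ := (hs.image Int.natAbs).bddAbove
  have hsa : ∀ i : ℤ, B < i.natAbs → s i = a i := by
    intro i hi
    by_contra hne
    have := hB ⟨i, hne, rfl⟩
    omega
  set k := B + R + 1 with hk
  have hL : k ≤ k * p := Nat.le_mul_of_pos_right k hp
  set m := 2 * k * p with hm
  set c : ℤ := -((k * p : ℕ) : ℤ) with hc
  have hmc : c + m = ((k * p : ℕ) : ℤ) := by
    rw [hc, hm]
    push_cast
    ring
  have hwin : ∀ x : ℤ, x ≤ c ∨ c + m ≤ x →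
      (fun j : Fin R => s (x + (j.val : ℤ))) = fun j : Fin R => a (x + (j.val : ℤ)) := by
    intro x hx
    funext j
    have := j.2
    exact hsa _ (by omega)
  have hmod : ∀ t : ℕ, ((c + t) % p).toNat = t % p := by
    intro t
    have h : c + t = t + p * (-k : ℤ) := by
      rw [hc]
      push_cast
      ring
    rw [h, Int.add_mul_emod_self_left]
    omega
  have hclosed : IsClosedWalk IsShift (fun (t : ℕ) (j : Fin R) => s (c + t + (j.val : ℤ))) m := by
    refine ⟨?_, fun t _ j _ => ?_⟩
    · change (fun j : Fin R => s (c + (m : ℤ) + (j.val : ℤ))) =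
        fun j : Fin R => s (c + ((0 : ℕ) : ℤ) + (j.val : ℤ))
      rw [hwin _ (Or.inr le_rfl), hwin _ (Or.inl (by simp)), haw, haw, hmod, hmod, hm]
      simp
    · push_cast
      congr 1
      ring
  have hE := hmin m _ hclosed
  have hA : ∑ t ∈ Finset.range m, φ (fun j => a (c + t + (j.val : ℤ))) =
      m * ((∑ t ∈ Finset.range p, φ (w t)) / p) := by
    have hp' : (p : ℝ) ≠ 0 := by exact_mod_cast (by omega : p ≠ 0)
    simp only [haw, hmod]
    rw [hm, sum_range_mul_mod (fun t => φ (w t))]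
    push_cast
    field_simp
  rw [finsum_eq_sum_of_support_subset (s := Finset.Ico c (c + m)), sum_Ico_int_eq_sum_range,
    Finset.sum_sub_distrib, hA]
  · exact sub_nonneg.2 hE
  · intro x hx
    by_contra hx'
    refine hx (sub_eq_zero.2 (congrArg φ (hwin x ?_)))
    simp only [Finset.coe_Ico, Set.mem_Ico, not_and_or, not_le, not_lt] at hx'
    omega
end

section
/- Every one-dimensional model with a finite-range potential and a finite number of periodic ground states satisfies the Peierls condition. Precisely: let S be a finite nonempty type, R ≥ 1, and φ : (Fin R → S) → ℝ a potential. Assume the set of periodic ground states of this model is finite and nonempty, say {a_1, …, a_r}, and let N ≥ R be an integer such that each a_q is invariant under translation by N. For a configuration s, let B(s) be the union of all frustrated windows, i.e., of all windows W_N(i) = {j ∈ ℤ : |j − i| ≤ N} on which the restriction of s differs from that of every a_q. Then there exists θ > 0 such that for every q ∈ {1, …, r} and every configuration s : ℤ → S equal to a_q outside a finite set, the relative Hamiltonian satisfies H(s, a_q) ≥ θ · |B(s)|, where |B(s)| denotes the number of sites in B(s). -/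
/-- Relative Hamiltonian of the one-dimensional model with finite-range potential `φ`
for two configurations equal almost everywhere (a finitely supported sum). -/
noncomputable def relH {S : Type*} {R : ℕ} (φ : (Fin R → S) → ℝ) (s s' : ℤ → S) : ℝ :=
  ∑ᶠ x : ℤ, (φ (fun j => s (x + (j.val : ℤ))) - φ (fun j => s' (x + (j.val : ℤ))))

/-- A configuration `a : ℤ → S` is periodic if it is invariant under translation by some
`p ≥ 1`. -/
def PeriodicConf {S : Type*} (a : ℤ → S) : Prop :=
  ∃ p : ℕ, 1 ≤ p ∧ ∀ i : ℤ, a (i + (p : ℤ)) = a i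

/-- A configuration `a` is a ground state for the potential `φ` if `H(s,a) ≥ 0` for every
configuration `s` equal to `a` almost everywhere. -/
def IsGroundState {S : Type*} {R : ℕ} (φ : (Fin R → S) → ℝ) (a : ℤ → S) : Prop :=
  ∀ s : ℤ → S, {i : ℤ | s i ≠ a i}.Finite → 0 ≤ relH φ s a

/-- The configuration `s` translated by `i`. -/
def shiftConf {S : Type*} (i : ℤ) (s : ℤ → S) : ℤ → S := fun x => s (i + x)

/-- The sum of `F` over the translates of `s` by `0, …, p - 1`. -/
def cycleSum {S : Type*} (F : (ℤ → S) → ℝ) (p : ℕ) (s : ℤ → S) : ℝ :=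
  ∑ t ∈ Finset.range p, F (shiftConf t s)

/-- `F` depends only on the coordinates in `[-N, N]`. -/
def IsLocal {S : Type*} (N : ℕ) (F : (ℤ → S) → ℝ) : Prop :=
  ∀ s t : ℤ → S, (∀ k : ℤ, |k| ≤ (N : ℤ) → s k = t k) → F s = F t

/-- The energy contribution of the block starting at the origin. -/
def blockEnergy {S : Type*} {R : ℕ} (φ : (Fin R → S) → ℝ) (s : ℤ → S) : ℝ :=
  φ fun j => s (j.val : ℤ)

section Shift

variable {S : Type*}

theorem shiftConf_shiftConf (i j : ℤ) (s : ℤ → S) :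
    shiftConf i (shiftConf j s) = shiftConf (j + i) s := by
  funext x
  simp [shiftConf, add_assoc]

theorem shiftConf_zero (s : ℤ → S) : shiftConf 0 s = s := by
  funext x
  simp [shiftConf]

theorem Function.Periodic.shiftConf {s : ℤ → S} {p : ℤ} (h : Function.Periodic s p) (i : ℤ) :
    Function.Periodic (shiftConf i s) p := by
  intro x
  have := h (i + x)
  simpa [_root_.shiftConf, add_assoc] using this

theorem Function.Periodic.shiftConf_eq {s : ℤ → S} {p : ℤ} (h : Function.Periodic s p) :
    _root_.shiftConf p s = s := by
  funext x
  have := h x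
  simpa [_root_.shiftConf, add_comm] using this

theorem isLocal_blockEnergy {R N : ℕ} (hRN : R ≤ N) (φ : (Fin R → S) → ℝ) :
    IsLocal N (blockEnergy φ) := by
  intro s t h
  unfold blockEnergy
  congr 1
  funext j
  apply h
  have := j.isLt
  rw [abs_le]
  omega

theorem IsLocal.cycleSum_congr {N : ℕ} {F : (ℤ → S) → ℝ} (hF : IsLocal N F) {p : ℕ}
    {s t : ℤ → S} (h : ∀ x : ℤ, -(N : ℤ) ≤ x → x ≤ p + N → s x = t x) :
    cycleSum F p s = cycleSum F p t := by
  refine Finset.sum_congr rfl fun i hi => hF _ _ fun k hk => ?_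
  rw [Finset.mem_range] at hi
  rw [abs_le] at hk
  exact h _ (by omega) (by omega)

theorem cycleSum_add (F : (ℤ → S) → ℝ) (p q : ℕ) (s : ℤ → S) :
    cycleSum F (p + q) s = cycleSum F p s + cycleSum F q (shiftConf p s) := by
  simp only [cycleSum, Finset.sum_range_add, shiftConf_shiftConf, Nat.cast_add]

theorem cycleSum_one (F : (ℤ → S) → ℝ) (s : ℤ → S) : cycleSum F 1 s = F s := by
  simp [cycleSum, shiftConf_zero]

theorem cycleSum_shiftConf (F : (ℤ → S) → ℝ) {p : ℕ} {s : ℤ → S}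
    (hs : Function.Periodic s (p : ℤ)) (i : ℤ) :
    cycleSum F p (shiftConf i s) = cycleSum F p s := by
  have step : ∀ t : ℤ → S, Function.Periodic t (p : ℤ) →
      cycleSum F p (shiftConf 1 t) = cycleSum F p t := by
    intro t ht
    have h1 := cycleSum_add F 1 p t
    have h2 := cycleSum_add F p 1 t
    rw [add_comm 1 p, h2, ht.shiftConf_eq, cycleSum_one] at h1
    push_cast at h1
    linarith
  induction i using Int.induction_on with
  | zero => rw [shiftConf_zero]
  | succ n ih =>
    have h := step _ (hs.shiftConf n)
    rw [shiftConf_shiftConf] at h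
    rw [h, ih]
  | pred n ih =>
    have h := step _ (hs.shiftConf (-(n : ℤ) - 1))
    rw [shiftConf_shiftConf, sub_add_cancel, ih] at h
    exact h.symm

theorem cycleSum_mul (F : (ℤ → S) → ℝ) {p : ℕ} {s : ℤ → S}
    (hs : Function.Periodic s (p : ℤ)) (n : ℕ) :
    cycleSum F (n * p) s = n * cycleSum F p s := by
  induction n with
  | zero => simp [cycleSum]
  | succ n ih =>
    rw [Nat.succ_mul, cycleSum_add, ih, cycleSum_shiftConf F hs]
    push_cast
    ring

/-- A configuration that repeats itself after `d` sites near the origin agrees with a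
`d`-periodic one on `[-N, d + N]`. -/
theorem exists_periodic_eqOn {N d : ℕ} (hd : 1 ≤ d) {s : ℤ → S}
    (h : ∀ x : ℤ, |x| ≤ (N : ℤ) → s (x + d) = s x) :
    ∃ c : ℤ → S, Function.Periodic c (d : ℤ) ∧
      ∀ x : ℤ, -(N : ℤ) ≤ x → x ≤ d + N → c x = s x := by
  refine ⟨fun x => s (x % d), fun x => by simp, ?_⟩
  have nonneg : ∀ n : ℕ, (n : ℤ) ≤ d + N → s ((n : ℤ) % d) = s n := by
    intro n
    induction n using Nat.strong_induction_on with
    | _ n ih =>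
      intro hn
      by_cases hlt : n < d
      · rw [Int.emod_eq_of_lt (by omega) (by omega)]
      · obtain ⟨m, rfl⟩ := Nat.exists_eq_add_of_le (not_lt.mp hlt)
        have h1 := ih m (by omega) (by omega)
        have h2 := h m (by rw [abs_le]; omega)
        push_cast
        rw [add_comm (d : ℤ) m, h2, ← h1, Int.add_emod_right]
  have neg : ∀ n : ℕ, n ≤ N → s ((-(n : ℤ)) % d) = s (-(n : ℤ)) := by
    intro n
    induction n using Nat.strong_induction_on with
    | _ n ih =>
      intro hn
      rw [← h (-(n : ℤ)) (by rw [abs_le]; omega), ← Int.add_emod_right]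
      by_cases hlt : n ≤ d
      · have := nonneg (d - n) (by omega)
        rw [Nat.cast_sub hlt] at this
        rw [neg_add_eq_sub]
        exact this
      · have := ih (n - d) (by omega) (by omega)
        rw [Nat.cast_sub (by omega), neg_sub] at this
        rw [neg_add_eq_sub]
        exact this
  intro x hx1 hx2
  obtain ⟨n, rfl | rfl⟩ := x.eq_nat_or_neg
  · exact nonneg n hx2
  · exact neg n (by omega)

/-- Nonnegativity of the energies of short cycles implies nonnegativity for all cycles. -/
theorem IsLocal.cycleSum_nonneg [Fintype S] {N : ℕ} {F : (ℤ → S) → ℝ} (hF : IsLocal N F)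
    (hshort : ∀ (p : ℕ) (c : ℤ → S), 1 ≤ p → p ≤ Nat.card (Fin (2 * N + 1) → S) →
      Function.Periodic c (p : ℤ) → 0 ≤ cycleSum F p c)
    (p : ℕ) (c : ℤ → S) (hp : 1 ≤ p) (hc : Function.Periodic c (p : ℤ)) :
    0 ≤ cycleSum F p c := by
  induction p using Nat.strong_induction_on generalizing c with
  | _ p ih =>
    by_cases hle : p ≤ Nat.card (Fin (2 * N + 1) → S)
    · exact hshort p c hp hle hc
    obtain ⟨i, d, hd, hdp, hwin⟩ : ∃ i d : ℕ, 1 ≤ d ∧ d < p ∧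
        ∀ x : ℤ, |x| ≤ (N : ℤ) → c (i + (x + d)) = c (i + x) := by
      let win : Fin p → Fin (2 * N + 1) → S := fun t k => c (t.val + (k.val - N))
      have key : ∀ i j : Fin p, i.val < j.val → win i = win j → ∃ i d : ℕ, 1 ≤ d ∧ d < p ∧
          ∀ x : ℤ, |x| ≤ (N : ℤ) → c (i + (x + d)) = c (i + x) := by
        intro i j hij hw
        refine ⟨i, j - i, by omega, by omega, fun x hx => ?_⟩
        rw [abs_le] at hx
        have := congrFun hw ⟨(x + N).toNat, by omega⟩
        simp only [win] at this
        rw [Int.toNat_of_nonneg (by omega)] at this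
        rw [show (i.val : ℤ) + (x + ((j.val - i.val : ℕ) : ℤ)) = j.val + (x + N - N) by omega,
          ← this]
        congr 1
        omega
      obtain ⟨i, j, hne, hw⟩ := Fintype.exists_ne_map_eq_of_card_lt win (by
        rw [Fintype.card_fin, ← Nat.card_eq_fintype_card]
        exact not_le.mp hle)
      rcases lt_or_gt_of_ne (Fin.val_ne_of_ne hne) with h | h
      · exact key i j h hw
      · exact key j i h hw.symm
    set s := shiftConf i c with hs_def
    have hs : Function.Periodic s (p : ℤ) := hc.shiftConf i
    have hsw : ∀ x : ℤ, |x| ≤ (N : ℤ) → s (x + d) = s x := hwin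
    obtain ⟨e, rfl⟩ := Nat.exists_eq_add_of_lt hdp
    obtain ⟨c₁, hc₁, he₁⟩ := exists_periodic_eqOn hd hsw
    obtain ⟨c₂, hc₂, he₂⟩ := exists_periodic_eqOn (N := N) (d := e + 1) (s := shiftConf d s)
      (by omega) (by
        intro x hx
        have h1 := hs x
        have h2 := hsw x hx
        simp only [shiftConf] at h1 h2 ⊢
        rw [add_comm (d : ℤ) x, h2, ← h1]
        congr 1
        push_cast
        ring)
    have h1 := ih d (by omega) c₁ hd hc₁
    have h2 := ih (e + 1) (by omega) c₂ (by omega) hc₂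
    rw [← cycleSum_shiftConf F hc i, ← hs_def, add_assoc, cycleSum_add,
      ← hF.cycleSum_congr he₁, ← hF.cycleSum_congr he₂]
    exact add_nonneg h1 h2

theorem relH_eq_cycleSum {R N : ℕ} (hRN : R ≤ N) (φ : (Fin R → S) → ℝ) {s a : ℤ → S} (b : ℤ)
    (p : ℕ) (h : ∀ x : ℤ, x < b + N ∨ b + p ≤ x → s x = a x) :
    relH φ s a = cycleSum (blockEnergy φ) p (shiftConf b s)
      - cycleSum (blockEnergy φ) p (shiftConf b a) := by
  have hsupp : ∀ x : ℤ, φ (fun j => s (x + (j.val : ℤ))) - φ (fun j => a (x + (j.val : ℤ))) ≠ 0 →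
      b ≤ x ∧ x < b + p := by
    intro x hx
    by_contra hcon
    apply hx
    rw [sub_eq_zero]
    congr 1
    funext j
    have := j.isLt
    exact h _ (by omega)
  unfold relH cycleSum
  rw [← Finset.sum_sub_distrib,
    finsum_eq_sum_of_support_subset (s := (Finset.range p).image fun t : ℕ => b + (t : ℤ))]
  · rw [Finset.sum_image (by intro x _ y _ hxy; simpa using hxy)]
    simp only [shiftConf_shiftConf]
    rfl
  · intro x hx
    have := hsupp x hx
    simp only [Finset.coe_image, Set.mem_image, Finset.coe_range, Set.mem_Iio]
    exact ⟨(x - b).toNat, by omega, by omega⟩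

/-- A finite perturbation of a periodic configuration can be closed up to a periodic one without
changing its relative energy. -/
theorem exists_periodic_relH_eq {R N : ℕ} (hRN : R ≤ N) (φ : (Fin R → S) → ℝ) {s a : ℤ → S}
    {q : ℕ} (hq : 1 ≤ q) (ha : Function.Periodic a (q : ℤ)) (hs : {i : ℤ | s i ≠ a i}.Finite) :
    ∃ (b : ℤ) (n : ℕ) (c : ℤ → S), 1 ≤ n ∧ Function.Periodic c ((n * q : ℕ) : ℤ) ∧
      (∀ x : ℤ, x < b + N ∨ b + (n * q : ℕ) - N ≤ x → s x = a x) ∧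
      (∀ x : ℤ, -(N : ℤ) ≤ x → x ≤ (n * q : ℕ) + N → c x = shiftConf b s x) ∧
      relH φ s a = cycleSum (blockEnergy φ) (n * q) c - n * cycleSum (blockEnergy φ) q a := by
  obtain ⟨K, hK⟩ : ∃ K : ℕ, ∀ x : ℤ, s x ≠ a x → |x| ≤ K := by
    obtain ⟨K, hK⟩ := (hs.image fun x : ℤ => x.natAbs).bddAbove
    refine ⟨K, fun x hx => ?_⟩
    have : x.natAbs ≤ K := hK ⟨x, hx, rfl⟩
    rw [Int.abs_eq_natAbs]
    exact_mod_cast this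
  have hKeq : ∀ x : ℤ, (K : ℤ) < |x| → s x = a x := fun x hx => by
    by_contra hne
    exact absurd (hK x hne) (not_le.mpr hx)
  set M := K + N + 1 with hM
  have hlarge : (2 * M : ℤ) ≤ ((2 * M * q : ℕ) : ℤ) := by
    exact_mod_cast Nat.le_mul_of_pos_right (2 * M) hq
  have hout : ∀ x : ℤ, x < -(M : ℤ) + N + 1 ∨ -(M : ℤ) + (2 * M * q : ℕ) - N ≤ x → s x = a x := by
    intro x hx
    apply hKeq
    rw [lt_abs]
    generalize ((2 * M * q : ℕ) : ℤ) = P at *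
    omega
  have haP : Function.Periodic a ((2 * M * q : ℕ) : ℤ) := by
    have := ha.nat_mul (2 * M)
    push_cast at this ⊢
    exact this
  obtain ⟨c, hc, hcs⟩ := exists_periodic_eqOn (N := N) (d := 2 * M * q)
    (s := shiftConf (-(M : ℤ)) s) (by have := hlarge; omega) (by
      intro x hx
      rw [abs_le] at hx
      simp only [shiftConf]
      rw [hout (-(M : ℤ) + x) (Or.inl (by omega)),
        hout (-(M : ℤ) + (x + (2 * M * q : ℕ))) (Or.inr (by omega)), ← add_assoc, haP])
  refine ⟨-(M : ℤ), 2 * M, c, by omega, hc, fun x hx => hout x (by omega), hcs, ?_⟩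
  rw [relH_eq_cycleSum hRN φ (-(M : ℤ)) (2 * M * q) (fun x hx => hout x (by omega)),
    cycleSum_shiftConf _ haP, cycleSum_mul _ ha,
    (isLocal_blockEnergy hRN φ).cycleSum_congr hcs]

theorem abs_cycleSum_le {F : (ℤ → S) → ℝ} {C : ℝ} (hC : ∀ s, |F s| ≤ C) (p : ℕ) (s : ℤ → S) :
    |cycleSum F p s| ≤ p * C := by
  refine (Finset.abs_sum_le_sum_abs _ _).trans ?_
  refine (Finset.sum_le_card_nsmul _ _ C fun t _ => hC _).trans ?_
  simp

theorem exists_abs_blockEnergy_le [Finite S] {R : ℕ} (φ : (Fin R → S) → ℝ) :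
    ∃ C : ℝ, 0 ≤ C ∧ ∀ s, |blockEnergy φ s| ≤ C := by
  obtain ⟨C, hC⟩ := (Set.finite_range fun w => |φ w|).bddAbove
  exact ⟨max C 0, le_max_right _ _, fun s => (hC ⟨_, rfl⟩).trans (le_max_left _ _)⟩

/-- Periodic ground states minimize the energy among configurations of the same period. -/
theorem IsGroundState.cycleSum_le_of_periodic [Finite S] {R : ℕ} {φ : (Fin R → S) → ℝ}
    {a c : ℤ → S} (hg : IsGroundState φ a) {p : ℕ}
    (ha : Function.Periodic a (p : ℤ)) (hc : Function.Periodic c (p : ℤ)) :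
    cycleSum (blockEnergy φ) p a ≤ cycleSum (blockEnergy φ) p c := by
  obtain ⟨C, hC0, hC⟩ := exists_abs_blockEnergy_le φ
  set F := blockEnergy φ with hF
  have bound : ∀ n : ℕ, 0 ≤ n * (cycleSum F p c - cycleSum F p a) + 4 * (R * C) := by
    intro n
    let s : ℤ → S := fun x => if 0 ≤ x ∧ x < ((n * p + R : ℕ) : ℤ) then c x else a x
    have hsa : ∀ x : ℤ, x < -(R : ℤ) + R ∨ -(R : ℤ) + ((R + (n * p + R) : ℕ) : ℤ) ≤ x →
        s x = a x := by
      intro x hx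
      refine if_neg fun hx' => ?_
      push_cast at hx hx'
      omega
    have hsc : cycleSum F (n * p) s = cycleSum F (n * p) c := by
      refine Finset.sum_congr rfl fun t ht => ?_
      rw [Finset.mem_range] at ht
      rw [hF]
      unfold blockEnergy
      congr 1
      funext j
      have := j.isLt
      exact if_pos (by omega)
    have h0 : 0 ≤ relH φ s a := by
      refine hg s ((Set.finite_Ico (0 : ℤ) ((n * p + R : ℕ) : ℤ)).subset fun x hx => ?_)
      by_contra hx'
      exact hx (if_neg hx')
    rw [relH_eq_cycleSum le_rfl φ (-(R : ℤ)) (R + (n * p + R)) hsa, ← hF, cycleSum_add,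
      cycleSum_add _ R, cycleSum_add, cycleSum_add, shiftConf_shiftConf _ _ s,
      shiftConf_shiftConf _ _ a, neg_add_cancel, shiftConf_zero, shiftConf_zero, hsc,
      cycleSum_mul F hc, cycleSum_mul F ha] at h0
    have h1 := abs_le.mp (abs_cycleSum_le hC R (shiftConf (-(R : ℤ)) s))
    have h2 := abs_le.mp (abs_cycleSum_le hC R (shiftConf (-(R : ℤ)) a))
    have h3 := abs_le.mp (abs_cycleSum_le hC R (shiftConf ((n * p : ℕ) : ℤ) s))
    have h4 := abs_le.mp (abs_cycleSum_le hC R (shiftConf ((n * p : ℕ) : ℤ) a))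
    linarith [h1.2, h2.1, h3.2, h4.1]
  by_contra! hlt
  obtain ⟨n, hn⟩ := exists_nat_gt (4 * (R * C) / (cycleSum F p a - cycleSum F p c))
  rw [div_lt_iff₀ (by linarith)] at hn
  linarith [bound n]

/-- The ground state energy per site: every cycle has at least this mean energy, and the periodic
ground states are exactly the periodic configurations that attain it. -/
theorem exists_groundState_energy [Finite S] {R : ℕ} {φ : (Fin R → S) → ℝ} {a : ℤ → S}
    (ha : PeriodicConf a) (hg : IsGroundState φ a) :
    ∃ e : ℝ, ∀ (p : ℕ) (c : ℤ → S), 1 ≤ p → Function.Periodic c (p : ℤ) →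
      p * e ≤ cycleSum (blockEnergy φ) p c ∧
      (IsGroundState φ c ↔ cycleSum (blockEnergy φ) p c = p * e) := by
  obtain ⟨q, hq, haq⟩ := ha
  have hq0 : (0 : ℝ) < q := by exact_mod_cast hq
  set F := blockEnergy φ with hF
  have compare : ∀ (p r : ℕ) (c d : ℤ → S), Function.Periodic c (p : ℤ) →
      Function.Periodic d (r : ℤ) → IsGroundState φ d →
      p * cycleSum F r d ≤ r * cycleSum F p c := by
    intro p r c d hc hd hgd
    rw [← cycleSum_mul F hd, ← cycleSum_mul F hc, mul_comm r p]
    refine hgd.cycleSum_le_of_periodic ?_ ?_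
    · have := hd.nat_mul p
      rwa [← Nat.cast_mul] at this
    · have := hc.nat_mul r
      rwa [← Nat.cast_mul, mul_comm] at this
  have lower : ∀ (p : ℕ) (c : ℤ → S), Function.Periodic c (p : ℤ) →
      p * (cycleSum F q a / q) ≤ cycleSum F p c := by
    intro p c hc
    rw [← mul_div_assoc, div_le_iff₀ hq0, mul_comm _ (q : ℝ)]
    exact compare p q c a hc haq hg
  refine ⟨cycleSum F q a / q, fun p c hp hc => ⟨lower p c hc, fun hgc => ?_, fun heq => ?_⟩⟩
  · refine le_antisymm ?_ (lower p c hc)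
    rw [← mul_div_assoc, le_div_iff₀ hq0, mul_comm _ (q : ℝ)]
    exact compare q p a c haq hc hgc
  · intro s hs
    obtain ⟨b, n, c', -, hc', -, -, hrel⟩ := exists_periodic_relH_eq le_rfl φ hp hc hs
    rw [hrel, ← hF, heq, sub_nonneg]
    refine le_trans (le_of_eq ?_) (lower (n * p) c' hc')
    push_cast
    ring

/-- The energies of short cycles take finitely many values, hence have a gap above zero. -/
theorem exists_gap_cycleSum [Finite S] {R : ℕ} (φ : (Fin R → S) → ℝ) (e : ℝ) (V : ℕ) :
    ∃ δ > (0 : ℝ), ∀ (p : ℕ) (c : ℤ → S), p ≤ V → 0 < cycleSum (blockEnergy φ) p c - p * e →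
      δ ≤ cycleSum (blockEnergy φ) p c - p * e := by
  let E : (Σ p : Fin (V + 1), Fin p → Fin R → S) → ℝ :=
    fun w => ∑ t, φ (w.2 t) - (w.1 : ℕ) * e
  have hfin : (Set.range E ∩ Set.Ioi 0).Finite := (Set.finite_range E).inter_of_left _
  have hmem : ∀ (p : ℕ) (c : ℤ → S), p ≤ V →
      cycleSum (blockEnergy φ) p c - p * e ∈ Set.range E := by
    intro p c hp
    refine ⟨⟨⟨p, by omega⟩, fun t j => c ((t : ℕ) + (j : ℕ))⟩, ?_⟩
    simp only [E, cycleSum, Finset.sum_range]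
    rfl
  rcases (Set.range E ∩ Set.Ioi 0).eq_empty_or_nonempty with h | h
  · refine ⟨1, one_pos, fun p c hp hpos => ?_⟩
    exact absurd ⟨hmem p c hp, hpos⟩ (Set.eq_empty_iff_forall_notMem.mp h _)
  · obtain ⟨δ, hδ, hmin⟩ := hfin.exists_minimal h
    refine ⟨δ, hδ.2, fun p c hp hpos => ?_⟩
    rcases le_total δ (cycleSum (blockEnergy φ) p c - p * e) with hle | hle
    · exact hle
    · exact hmin ⟨hmem p c hp, hpos⟩ hle

end Shift

/-- The indicator that the window `[-N, N]` of `s` differs from every element of `G`. -/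
noncomputable def frustration {S : Type*} (G : Set (ℤ → S)) (N : ℕ) (s : ℤ → S) : ℝ :=
  open Classical in if ∀ a ∈ G, ∃ k : ℤ, |k| ≤ (N : ℤ) ∧ s k ≠ a k then 1 else 0

theorem isLocal_frustration {S : Type*} (G : Set (ℤ → S)) (N : ℕ) :
    IsLocal N (frustration G N) := by
  intro s t h
  unfold frustration
  congr 1
  refine propext (forall₂_congr fun a _ => exists_congr fun k => and_congr_right fun hk => ?_)
  rw [h k hk]

theorem frustration_of_mem {S : Type*} {G : Set (ℤ → S)} {a : ℤ → S} (N : ℕ) (ha : a ∈ G) :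
    frustration G N a = 0 :=
  if_neg fun h => by
    obtain ⟨k, -, hk⟩ := h a ha
    exact hk rfl

theorem frustration_le_one {S : Type*} (G : Set (ℤ → S)) (N : ℕ) (s : ℤ → S) :
    frustration G N s ≤ 1 := by
  unfold frustration
  split_ifs <;> norm_num

theorem cycleSum_sub_const_sub_mul {S : Type*} (F f : (ℤ → S) → ℝ) (e ε : ℝ) (p : ℕ) (s : ℤ → S) :
    cycleSum (fun c => F c - e - ε * f c) p s
      = cycleSum F p s - p * e - ε * cycleSum f p s := by
  simp [cycleSum, Finset.sum_sub_distrib, Finset.mul_sum]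

/-- A configuration all of whose frustrated windows are centred in `[b, b + p)` has at most
`2 * N + 1` times as many frustrated sites as frustrated windows. -/
theorem ncard_frustrated_le {S : Type*} {G : Set (ℤ → S)} {N : ℕ} {s : ℤ → S} (b : ℤ) (p : ℕ)
    (hG : ∀ i : ℤ, ∀ a ∈ G, shiftConf i a ∈ G)
    (hloc : ∀ i : ℤ, i < b ∨ b + p ≤ i → ∃ a ∈ G, ∀ k : ℤ, |k - i| ≤ (N : ℤ) → s k = a k) :
    (({j : ℤ | ∃ i : ℤ, |j - i| ≤ (N : ℤ) ∧
        ∀ a ∈ G, ∃ k : ℤ, |k - i| ≤ (N : ℤ) ∧ s k ≠ a k}).ncard : ℝ)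
      ≤ (2 * N + 1) * cycleSum (frustration G N) p (shiftConf b s) := by
  classical
  let T := (Finset.range p).filter fun t : ℕ =>
    ∀ a ∈ G, ∃ k : ℤ, |k| ≤ (N : ℤ) ∧ shiftConf t (shiftConf b s) k ≠ a k
  have hsum : cycleSum (frustration G N) p (shiftConf b s) = T.card := by
    simp only [cycleSum, frustration, T]
    rw [Finset.sum_ite]
    simp
  have hsub : {j : ℤ | ∃ i : ℤ, |j - i| ≤ (N : ℤ) ∧
      ∀ a ∈ G, ∃ k : ℤ, |k - i| ≤ (N : ℤ) ∧ s k ≠ a k}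
        ⊆ (T.biUnion fun t : ℕ => Finset.Icc (b + t - N : ℤ) (b + t + N) : Finset ℤ) := by
    rintro j ⟨i, hji, hi⟩
    have hib : b ≤ i ∧ i < b + p := by
      by_contra hcon
      obtain ⟨a, haG, hak⟩ := hloc i (by omega)
      obtain ⟨k, hk, hne⟩ := hi a haG
      exact hne (hak k hk)
    obtain ⟨t, ht⟩ := Int.eq_ofNat_of_zero_le (sub_nonneg.mpr hib.1)
    obtain rfl : i = b + t := by omega
    rw [abs_le] at hji
    simp only [Finset.coe_biUnion, Set.mem_iUnion, Finset.coe_Icc, Set.mem_Icc, Finset.mem_coe]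
    refine ⟨t, ?_, by omega, by omega⟩
    simp only [T, Finset.mem_filter, Finset.mem_range]
    refine ⟨by omega, fun a haG => ?_⟩
    obtain ⟨k, hk, hne⟩ := hi _ (hG (-(b + t)) a haG)
    refine ⟨k - (b + t), hk, ?_⟩
    rw [shiftConf_shiftConf, shiftConf, add_sub_cancel]
    rwa [shiftConf, neg_add_eq_sub] at hne
  have hcard : (T.biUnion fun t : ℕ => Finset.Icc (b + t - N : ℤ) (b + t + N)).card
      ≤ T.card * (2 * N + 1) := by
    refine Finset.card_biUnion_le_card_mul _ _ _ fun t _ => ?_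
    rw [Int.card_Icc]
    omega
  have hle := (Set.ncard_le_ncard hsub (Finset.finite_toSet _)).trans
    ((Set.ncard_coe_finset _).trans_le hcard)
  rw [hsum, mul_comm]
  exact_mod_cast hle

/-- Every one-dimensional model with a finite-range potential and a finite nonempty set of
periodic ground states, all invariant under translation by `N ≥ R`, satisfies the Peierls
condition: there is `θ > 0` such that `H(s, a) ≥ θ·|B(s)|` for every ground state `a` and
every `s` equal to `a` almost everywhere, where `B(s)` is the union of all frustrated
windows `W_N(i) = {j : |j − i| ≤ N}` (windows on which `s` differs from every ground
state). -/
theorem peierls_condition_of_finitely_many_periodic_ground_states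
    {S : Type*} [Fintype S] [Nonempty S] (R : ℕ) (hR : 1 ≤ R) (φ : (Fin R → S) → ℝ)
    (G : Set (ℤ → S)) (hG : G = {a | PeriodicConf a ∧ IsGroundState φ a})
    (hGfin : G.Finite) (hGne : G.Nonempty)
    (N : ℕ) (hRN : R ≤ N) (hinv : ∀ a ∈ G, ∀ i : ℤ, a (i + (N : ℤ)) = a i) :
    ∃ θ > (0 : ℝ), ∀ a ∈ G, ∀ s : ℤ → S, {i : ℤ | s i ≠ a i}.Finite →
      θ * (({j : ℤ | ∃ i : ℤ, |j - i| ≤ (N : ℤ) ∧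
              ∀ a' ∈ G, ∃ k : ℤ, |k - i| ≤ (N : ℤ) ∧ s k ≠ a' k}).ncard : ℝ)
        ≤ relH φ s a := by
  have hmemG : ∀ (p : ℕ) (c : ℤ → S), 1 ≤ p → Function.Periodic c (p : ℤ) →
      (c ∈ G ↔ IsGroundState φ c) := by
    intro p c hp hc
    rw [hG]
    exact and_iff_right ⟨p, hp, hc⟩
  have hper : ∀ a ∈ G, ∃ p : ℕ, 1 ≤ p ∧ Function.Periodic a (p : ℤ) := by
    intro a ha
    rw [hG] at ha
    exact ha.1
  obtain ⟨e, he⟩ : ∃ e : ℝ, ∀ (p : ℕ) (c : ℤ → S), 1 ≤ p → Function.Periodic c (p : ℤ) →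
      p * e ≤ cycleSum (blockEnergy φ) p c ∧
      (c ∈ G ↔ cycleSum (blockEnergy φ) p c = p * e) := by
    obtain ⟨a₀, ha₀⟩ := hGne
    rw [hG] at ha₀
    obtain ⟨e, he⟩ := exists_groundState_energy ha₀.1 ha₀.2
    refine ⟨e, fun p c hp hc => ?_⟩
    rw [hmemG p c hp hc]
    exact he p c hp hc
  have hshift : ∀ i : ℤ, ∀ a ∈ G, shiftConf i a ∈ G := by
    intro i a ha
    obtain ⟨p, hp, hap⟩ := hper a ha
    rw [(he p _ hp (hap.shiftConf i)).2, cycleSum_shiftConf _ hap]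
    exact (he p a hp hap).2.mp ha
  set V := Nat.card (Fin (2 * N + 1) → S) with hV
  obtain ⟨δ, hδ, hgap⟩ := exists_gap_cycleSum φ e V
  set ε := δ / (V + 1) with hε
  have hε0 : 0 < ε := by positivity
  have hlocal : IsLocal N fun c => blockEnergy φ c - e - ε * frustration G N c := by
    intro s t h
    simp only [isLocal_blockEnergy hRN φ s t h, isLocal_frustration G N s t h]
  have hcycle := hlocal.cycleSum_nonneg (by
    intro p c hp hpV hc
    rw [cycleSum_sub_const_sub_mul]
    rcases (he p c hp hc).1.eq_or_lt with heq | hlt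
    · have hcG : c ∈ G := (he p c hp hc).2.mpr heq.symm
      have hzero : cycleSum (frustration G N) p c = 0 :=
        Finset.sum_eq_zero fun t _ => frustration_of_mem N (hshift _ _ hcG)
      rw [hzero, heq]
      simp
    · have h1 := hgap p c hpV (sub_pos.mpr hlt)
      have h2 : cycleSum (frustration G N) p c ≤ V + 1 := by
        refine (Finset.sum_le_card_nsmul _ _ 1 fun t _ => frustration_le_one G N _).trans ?_
        simp only [Finset.card_range, nsmul_eq_mul, mul_one]
        exact_mod_cast hpV.trans (Nat.le_succ V)
      have h3 : ε * cycleSum (frustration G N) p c ≤ δ := by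
        refine (mul_le_mul_of_nonneg_left h2 hε0.le).trans (le_of_eq ?_)
        rw [hε]
        field_simp
      linarith)
  refine ⟨ε / (2 * N + 1), by positivity, fun a ha s hs => ?_⟩
  obtain ⟨q, hq, haq⟩ := hper a ha
  obtain ⟨b, n, c, hn, hc, hout, hcs, hrel⟩ := exists_periodic_relH_eq hRN φ hq haq hs
  have hB := ncard_frustrated_le (N := N) (s := s) b (n * q) hshift (by
    intro i hi
    refine ⟨a, ha, fun k hk => hout k ?_⟩
    rw [abs_le] at hk
    omega)
  have hnonneg := hcycle (n * q) c (Nat.mul_pos hn hq) hc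
  rw [cycleSum_sub_const_sub_mul, (isLocal_frustration G N).cycleSum_congr hcs] at hnonneg
  rw [hrel, (he q a hq haq).2.mp ha, div_mul_eq_mul_div, div_le_iff₀ (by positivity)]
  push_cast at hnonneg
  calc _ ≤ ε * ((2 * N + 1) * cycleSum (frustration G N) (n * q) (shiftConf b s)) :=
        mul_le_mul_of_nonneg_left hB hε0.le
    _ = ε * cycleSum (frustration G N) (n * q) (shiftConf b s) * (2 * N + 1) := by ring
    _ ≤ _ := by
        refine mul_le_mul_of_nonneg_right ?_ (by positivity)
        linarith
end

section
/- (Ground states of the laminated model; forward part of Proposition 2.1 of the paper.) Let S be a finite nonempty type, d ≥ 1, R ≥ 1, φ : ((Fin R → Fin R → … (d times) → S analogue; formally φ : ({0,…,R−1}^d → S) → ℝ) a finite-range horizontal potential, and λ > 0 the Potts coupling constant. If a : ℤ^d → S is a ground state of the horizontal model, i.e., H_g(s,a) ≥ 0 for every s : ℤ^d → S equal to a outside a finite set, then the lifted configuration ā : ℤ^d × ℤ → S defined by ā(x,t) = a(x) is a ground state of the laminated model: for every configuration s : ℤ^d × ℤ → S equal to ā outside a finite set, the laminated relative Hamiltonian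 satisfies H(s, ā) ≥ 0. Moreover, if a is invariant under a finite-index subgroup Ẑ ⊆ ℤ^d, then ā is invariant under Ẑ × ℤ. -/
/-- Relative Hamiltonian of the horizontal `d`-dimensional model with finite-range
potential `φ` (a finitely supported sum over `ℤ^d`). -/
noncomputable def relHg {S : Type*} {d R : ℕ} (φ : ((Fin d → Fin R) → S) → ℝ)
    (s s' : (Fin d → ℤ) → S) : ℝ :=
  ∑ᶠ x : Fin d → ℤ,
    (φ (fun j => s (fun k => x k + ((j k).val : ℤ)))
      - φ (fun j => s' (fun k => x k + ((j k).val : ℤ))))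

open Classical in
/-- Relative Hamiltonian of the laminated model on `ℤ^d × ℤ`: horizontal interaction `φ`
in every layer plus the vertical Potts interaction of strength `lam` along the columns. -/
noncomputable def relHlam {S : Type*} {d R : ℕ} (φ : ((Fin d → Fin R) → S) → ℝ) (lam : ℝ)
    (s s' : (Fin d → ℤ) × ℤ → S) : ℝ :=
  (∑ᶠ t : ℤ, relHg φ (fun x => s (x, t)) (fun x => s' (x, t)))
    + lam * ∑ᶠ p : (Fin d → ℤ) × ℤ,
        ((if s p ≠ s (p.1, p.2 + 1) then (1 : ℝ) else 0)
          - (if s' p ≠ s' (p.1, p.2 + 1) then (1 : ℝ) else 0))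

/-- Ground states of the laminated model (forward part of Proposition 2.1):  if `a` is a
ground state of the horizontal model, then the lifted configuration `ā(x,t) = a(x)` is a
ground state of the laminated model; moreover, if `a` is invariant under a finite-index
subgroup `Ẑ ⊆ ℤ^d`, then `ā` is invariant under `Ẑ × ℤ`. -/
theorem lifted_ground_state_of_laminated_model {S : Type*} [Fintype S] [Nonempty S]
    (d R : ℕ) (hd : 1 ≤ d) (hR : 1 ≤ R)
    (φ : ((Fin d → Fin R) → S) → ℝ) (lam : ℝ) (hlam : 0 < lam)
    (a : (Fin d → ℤ) → S)
    (ha : ∀ s : (Fin d → ℤ) → S, {x | s x ≠ a x}.Finite → 0 ≤ relHg φ s a)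
    (abar : (Fin d → ℤ) × ℤ → S) (habar : ∀ x t, abar (x, t) = a x) :
    (∀ s : (Fin d → ℤ) × ℤ → S, {p | s p ≠ abar p}.Finite → 0 ≤ relHlam φ lam s abar)
    ∧ (∀ Z : AddSubgroup (Fin d → ℤ), Z.FiniteIndex →
        (∀ z ∈ Z, ∀ x, a (x + z) = a x) →
        ∀ z ∈ Z, ∀ u : ℤ, ∀ x t, abar (x + z, t + u) = abar (x, t)) := by
  obtain rfl : abar = fun p => a p.1 := funext fun p => habar p.1 p.2
  refine ⟨fun s hs => ?_, fun Z _ hZ z hz _ x _ => hZ z hz x⟩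
  refine add_nonneg (finsum_nonneg fun t => ha _ ?_)
    (mul_nonneg hlam.le (finsum_nonneg fun p => ?_))
  · exact hs.preimage (f := fun x => (x, t)) fun _ _ _ _ h => congrArg Prod.fst h
  · simp only [ne_eq, not_true_eq_false, if_false, sub_zero]
    split_ifs <;> norm_num
end

section
/- (Counting estimate underlying the fact that every uv-functional is a πτ-functional, Proposition 4.1 of the paper.) Let S be a finite nonempty type, and let l ≥ 1, n ≥ 1 be integers and u, v, τ real numbers satisfying |S| · e^{−u} + |S|^l · e^{−u − v·l} ≤ e^{−τ}. Then ∑_{f : Fin n → (Fin l → S)} exp(−u·n − v·l·N(f)) ≤ e^{−τ·n}, where N(f) is the number of indices i ∈ Fin n such that the column f(i) : Fin l → S is not a constant function. -/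
open Classical in
/-- A sum over configurations of a weight exponential in the number of columns satisfying `p`
factorizes over the columns. -/
theorem sum_exp_ncard_eq_pow {α : Type*} [Fintype α] (p : α → Prop) (n : ℕ) (a b : ℝ) :
    ∑ f : Fin n → α, Real.exp (a * n - b * ({i : Fin n | p (f i)}.ncard : ℝ))
      = (∑ x : α, Real.exp (if p x then a - b else a)) ^ n := by
  rw [← Fintype.card_fin n, ← Finset.card_univ, ← Finset.prod_const, Finset.prod_univ_sum,
    Fintype.piFinset_univ, Finset.card_univ, Fintype.card_fin]
  refine Finset.sum_congr rfl fun f _ => ?_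
  have hcard : ({i : Fin n | p (f i)}.ncard : ℝ) = ∑ i : Fin n, if p (f i) then (1 : ℝ) else 0 := by
    rw [Finset.sum_boole, ← Set.ncard_coe_finset, Finset.coe_filter_univ]
  have hconst : a * n = ∑ _i : Fin n, a := by simp [mul_comm]
  rw [← Real.exp_sum, hcard, hconst, Finset.mul_sum, ← Finset.sum_sub_distrib]
  congr 1
  refine Finset.sum_congr rfl fun i _ => ?_
  split_ifs <;> ring

open Classical in
/-- There are at most `|S|` constant functions from a nonempty type into `S`. -/
theorem card_filter_const_le {ι S : Type*} [Fintype ι] [Nonempty ι] [Fintype S] :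
    (Finset.univ.filter fun g : ι → S => ∃ c, ∀ j, g j = c).card ≤ Fintype.card S := by
  refine (Finset.card_le_card (t := Finset.univ.image (Function.const ι)) ?_).trans
    Finset.card_image_le
  intro g hg
  obtain ⟨c, hc⟩ := (Finset.mem_filter.mp hg).2
  exact Finset.mem_image.mpr ⟨c, Finset.mem_univ c, (funext hc).symm⟩

open Classical in
/-- The total weight of a single column: constant columns weigh `exp a`, the others `exp b`. -/
theorem sum_exp_column_le {ι S : Type*} [Fintype ι] [Nonempty ι] [Fintype S] (a b : ℝ) :
    ∑ g : ι → S, Real.exp (if ¬ ∃ c, ∀ j, g j = c then b else a)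
      ≤ (Fintype.card S : ℝ) * Real.exp a
        + (Fintype.card S : ℝ) ^ Fintype.card ι * Real.exp b := by
  simp only [apply_ite Real.exp, ite_not]
  rw [Finset.sum_ite, Finset.sum_const, Finset.sum_const, nsmul_eq_mul, nsmul_eq_mul]
  gcongr
  · exact card_filter_const_le
  · rw [← Nat.cast_pow, ← Fintype.card_fun]
    exact_mod_cast Finset.card_le_univ _


/-- Counting estimate underlying the fact that every `uv`-functional is a `πτ`-functional:
summing `exp(−u·n − v·l·N(f))` over all configurations `f` on a support of `n` columns of
height `l`, where `N(f)` is the number of non-constant (variable) columns, is at most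
`exp(−τ·n)` provided `|S|·e^{−u} + |S|^l·e^{−u−v·l} ≤ e^{−τ}`. -/
theorem uv_functional_is_pitau_functional_estimate
    {S : Type*} [Fintype S] [Nonempty S] (l n : ℕ) (hl : 1 ≤ l) (hn : 1 ≤ n)
    (u v τ : ℝ)
    (h : (Fintype.card S : ℝ) * Real.exp (-u)
        + (Fintype.card S : ℝ) ^ l * Real.exp (-u - v * l) ≤ Real.exp (-τ)) :
    ∑ f : Fin n → (Fin l → S),
        Real.exp (-u * n - v * l * ({i : Fin n | ¬ ∃ c, ∀ j, f i j = c}.ncard : ℝ))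
      ≤ Real.exp (-τ * n) := by
  classical
  have : Nonempty (Fin l) := ⟨⟨0, hl⟩⟩
  rw [sum_exp_ncard_eq_pow (fun g : Fin l → S => ¬ ∃ c, ∀ j, g j = c) n (-u) (v * l),
    mul_comm (-τ), Real.exp_nat_mul]
  refine pow_le_pow_left₀ (Finset.sum_nonneg fun g _ => (Real.exp_pos _).le) ?_ n
  have hcol := sum_exp_column_le (ι := Fin l) (S := S) (-u) (-u - v * l)
  rw [Fintype.card_fin] at hcol
  convert hcol.trans h
end

section
/- (Lemma 4.5 of the paper.) Let m ≥ 2, c > 1 a real number, and V a nonempty finite subset of ℤ^m. Let M_1, …, M_n be nonempty finite connected subsets of ℤ^m that are pairwise distant (d(M_i, M_j) > 1 for i ≠ j) and satisfy, for each i: M_i ⊆ V, d(M_i, ℤ^m ∖ V) > 1, and Int M_i ⊆ V. Then ∑_{i=1}^n (|M_i| + |Int M_i|) · c^{δ(M_i)} < (c^{δ(V)} / (c − 1)) · |V|, where |A| denotes the cardinality of A and δ(A) its ℓ∞-diameter. -/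
/-- ℓ∞ adjacency on `ℤ^m`: distinct points at `ℓ∞` distance at most `1`. -/
def Adj {m : ℕ} (x y : Fin m → ℤ) : Prop := x ≠ y ∧ ∀ k, |x k - y k| ≤ 1

/-- One step of a chain inside `B`: adjacent points both lying in `B`. -/
def Step {m : ℕ} (B : Set (Fin m → ℤ)) (p q : Fin m → ℤ) : Prop :=
  Adj p q ∧ p ∈ B ∧ q ∈ B

/-- The connected component of `x` inside `B` (points reachable from `x` by chains in `B`). -/
def component {m : ℕ} (B : Set (Fin m → ℤ)) (x : Fin m → ℤ) : Set (Fin m → ℤ) :=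
  {y | Relation.ReflTransGen (Step B) x y}

/-- A set is connected if any two of its points are joined by a chain inside it. -/
def ConnectedIn {m : ℕ} (B : Set (Fin m → ℤ)) : Prop :=
  ∀ x ∈ B, ∀ y ∈ B, Relation.ReflTransGen (Step B) x y

/-- Two sets are distant if every pair of points, one from each, is at `ℓ∞` distance `> 1`. -/
def Distant {m : ℕ} (K L : Set (Fin m → ℤ)) : Prop :=
  ∀ x ∈ K, ∀ y ∈ L, ∃ k, 1 < |x k - y k|

/-- `Int M`: the union of all finite connected components of the complement of `M`. -/
def interior' {m : ℕ} (M : Set (Fin m → ℤ)) : Set (Fin m → ℤ) :=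
  {y | ∃ x, x ∉ M ∧ (component Mᶜ x).Finite ∧ y ∈ component Mᶜ x}

/-- ℓ∞ diameter of a set `A ⊆ ℤ^m` (as a supremum of coordinate distances). -/
noncomputable def diam {m : ℕ} (A : Set (Fin m → ℤ)) : ℤ :=
  sSup {d : ℤ | ∃ x ∈ A, ∃ y ∈ A, ∃ k, d = |x k - y k|}

theorem Adj.symm {m : ℕ} {x y : Fin m → ℤ} (h : Adj x y) : Adj y x :=
  ⟨h.1.symm, fun k => by rw [abs_sub_comm]; exact h.2 k⟩

theorem reflTransGen_step_symm {m : ℕ} {B : Set (Fin m → ℤ)} {x y : Fin m → ℤ}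
    (h : Relation.ReflTransGen (Step B) x y) : Relation.ReflTransGen (Step B) y x := by
  induction h with
  | refl => exact .refl
  | tail _ h ih => exact .head ⟨h.1.symm, h.2.2, h.2.1⟩ ih

theorem mem_of_reflTransGen_step {m : ℕ} {B : Set (Fin m → ℤ)} {x y : Fin m → ℤ}
    (hx : x ∈ B) (h : Relation.ReflTransGen (Step B) x y) : y ∈ B := by
  induction h with
  | refl => exact hx
  | tail _ h _ => exact h.2.2

theorem component_eq {m : ℕ} {B : Set (Fin m → ℤ)} {x y : Fin m → ℤ}
    (h : y ∈ component B x) : component B y = component B x :=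
  Set.ext fun _ => ⟨fun hz => Relation.ReflTransGen.trans h hz,
    fun hz => (reflTransGen_step_symm h).trans hz⟩

theorem mem_interior'_iff {m : ℕ} {M : Set (Fin m → ℤ)} {y : Fin m → ℤ} :
    y ∈ interior' M ↔ y ∉ M ∧ (component Mᶜ y).Finite := by
  constructor
  · rintro ⟨x, hx, hfin, hy⟩
    exact ⟨mem_of_reflTransGen_step (B := Mᶜ) hx hy, by rwa [component_eq hy]⟩
  · rintro ⟨hy, hfin⟩
    exact ⟨y, hy, hfin, Relation.ReflTransGen.refl⟩

theorem component_subset_interior' {m : ℕ} {M : Set (Fin m → ℤ)} {y : Fin m → ℤ}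
    (hy : y ∈ interior' M) : component Mᶜ y ⊆ interior' M := by
  rw [mem_interior'_iff] at hy
  exact fun z hz => ⟨y, hy.1, hy.2, hz⟩

theorem disjoint_interior' {m : ℕ} (M : Set (Fin m → ℤ)) : Disjoint M (interior' M) :=
  Set.disjoint_left.2 fun _ hx hx' => (mem_interior'_iff.1 hx').1 hx

/-- A ray leaves every finite set. -/
theorem exists_ray_exit {m : ℕ} {C : Set (Fin m → ℤ)} (hC : C.Finite) {x : Fin m → ℤ}
    (hx : x ∈ C) (k : Fin m) {s : ℤ} (hs : s ≠ 0) :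
    ∃ t : ℕ, Function.update x k (x k + s * t) ∈ C ∧
      Function.update x k (x k + s * (t + 1 : ℕ)) ∉ C := by
  by_contra! h
  have hall : ∀ t : ℕ, Function.update x k (x k + s * t) ∈ C := by
    intro t
    induction t with
    | zero => simpa using hx
    | succ t ih => exact h t ih
  refine Set.infinite_of_injective_forall_mem (fun t u htu => ?_) hall hC
  have := congrFun htu k
  simpa [hs] using this

theorem adj_update {m : ℕ} (x : Fin m → ℤ) (k : Fin m) {a b : ℤ} (h : |a - b| = 1) :
    Adj (Function.update x k a) (Function.update x k b) := by
  refine ⟨fun he => ?_, fun j => ?_⟩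
  · have := congrFun he k
    simp only [Function.update_self] at this
    simp [this] at h
  · obtain rfl | hj := eq_or_ne j k
    · simp [h]
    · simp [hj]

/-- A point adjacent to a component of `Mᶜ`, but outside it, lies in `M`. -/
theorem mem_of_adj_component {m : ℕ} {M : Set (Fin m → ℤ)} {x y z : Fin m → ℤ}
    (hx : x ∉ M) (hy : y ∈ component Mᶜ x) (hz : z ∉ component Mᶜ x) (h : Adj y z) :
    z ∈ M := by
  by_contra hzM
  exact hz (Relation.ReflTransGen.tail hy ⟨h, mem_of_reflTransGen_step (B := Mᶜ) hx hy, hzM⟩)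

/-- In each signed coordinate direction, `M` extends strictly beyond its interior. -/
theorem exists_mem_beyond {m : ℕ} {M : Set (Fin m → ℤ)} {x : Fin m → ℤ}
    (hx : x ∈ interior' M) (k : Fin m) {s : ℤ} (hs : |s| = 1) :
    ∃ z ∈ M, s * x k < s * z k := by
  rw [mem_interior'_iff] at hx
  have hs0 : s ≠ 0 := by rintro rfl; simp at hs
  obtain ⟨t, hin, hout⟩ := exists_ray_exit hx.2 Relation.ReflTransGen.refl k hs0
  refine ⟨_, mem_of_adj_component hx.1 hin hout (adj_update x k ?_), ?_⟩
  · rw [← hs, ← abs_neg s]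
    congr 1
    push_cast
    ring
  · have : s * s = 1 := by rw [← abs_mul_abs_self, hs]; rfl
    simp only [Function.update_self]
    push_cast
    nlinarith

theorem finite_diam_set {m : ℕ} {A : Set (Fin m → ℤ)} (hA : A.Finite) :
    {d : ℤ | ∃ x ∈ A, ∃ y ∈ A, ∃ k, d = |x k - y k|}.Finite := by
  refine ((hA.prod (hA.prod (Set.finite_univ (α := Fin m)))).image
    fun p => |p.1 p.2.2 - p.2.1 p.2.2|).subset ?_
  rintro d ⟨x, hx, y, hy, k, rfl⟩
  exact ⟨(x, y, k), ⟨hx, hy, trivial⟩, rfl⟩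

theorem sub_le_diam {m : ℕ} {A : Set (Fin m → ℤ)} (hA : A.Finite) {x y : Fin m → ℤ}
    (hx : x ∈ A) (hy : y ∈ A) (k : Fin m) : x k - y k ≤ diam A :=
  (le_abs_self _).trans (le_csSup (finite_diam_set hA).bddAbove ⟨x, hx, y, hy, k, rfl⟩)

theorem exists_diam_eq {m : ℕ} (hm : 0 < m) {A : Set (Fin m → ℤ)} (hA : A.Finite)
    (hne : A.Nonempty) : ∃ x ∈ A, ∃ y ∈ A, ∃ k, diam A = x k - y k := by
  obtain ⟨a, ha⟩ := hne
  obtain ⟨x, hx, y, hy, k, h⟩ :=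
    Int.csSup_mem (s := {d : ℤ | ∃ x ∈ A, ∃ y ∈ A, ∃ k, d = |x k - y k|})
      ⟨_, a, ha, a, ha, ⟨0, hm⟩, rfl⟩ (finite_diam_set hA).bddAbove
  change diam A = _ at h
  rcases abs_choice (x k - y k) with h' | h' <;> rw [h'] at h
  · exact ⟨x, hx, y, hy, k, h⟩
  · exact ⟨y, hy, x, hx, k, by rw [h]; ring⟩

theorem diam_nonneg {m : ℕ} (hm : 0 < m) {A : Set (Fin m → ℤ)} (hA : A.Finite)
    (hne : A.Nonempty) : 0 ≤ diam A := by
  obtain ⟨a, ha⟩ := hne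
  simpa using sub_le_diam hA ha ha ⟨0, hm⟩

theorem diam_lt_of_subset_interior' {m : ℕ} (hm : 0 < m) {K M : Set (Fin m → ℤ)}
    (hK : K.Finite) (hKne : K.Nonempty) (hM : M.Finite) (h : K ⊆ interior' M) :
    diam K < diam M := by
  obtain ⟨x, hx, y, hy, k, hd⟩ := exists_diam_eq hm hK hKne
  obtain ⟨z, hz, hxz⟩ := exists_mem_beyond (h hx) k (s := 1) (by norm_num)
  obtain ⟨w, hw, hyw⟩ := exists_mem_beyond (h hy) k (s := -1) (by norm_num)
  have := sub_le_diam hM hz hw k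
  linarith

theorem diam_lt_of_distant_compl {m : ℕ} (hm : 0 < m) {M V : Set (Fin m → ℤ)}
    (hM : M.Finite) (hMne : M.Nonempty) (hV : V.Finite) (hMV : M ⊆ V) (h : Distant M Vᶜ) :
    diam M < diam V := by
  obtain ⟨x, hx, y, hy, k, hd⟩ := exists_diam_eq hm hM hMne
  have hmem : Function.update x k (x k + 1) ∈ V := by
    by_contra hn
    obtain ⟨j, hj⟩ := h x hx _ hn
    obtain rfl | hjk := eq_or_ne j k
    · simp at hj
    · simp [hjk] at hj
  have := sub_le_diam hV hmem (hMV hy) k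
  rw [Function.update_self] at this
  linarith

theorem Distant.disjoint {m : ℕ} {K L : Set (Fin m → ℤ)} (h : Distant K L) : Disjoint K L :=
  Set.disjoint_left.2 fun x hx hx' => by
    obtain ⟨k, hk⟩ := h x hx x hx'
    simp at hk

theorem reflTransGen_step_mono {m : ℕ} {A B : Set (Fin m → ℤ)} (h : A ⊆ B)
    {x y : Fin m → ℤ} (hxy : Relation.ReflTransGen (Step A) x y) :
    Relation.ReflTransGen (Step B) x y :=
  Relation.ReflTransGen.mono (fun _ _ hs => ⟨hs.1, h hs.2.1, h hs.2.2⟩) _ _ hxy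

/-- A connected set avoiding `M` and meeting `Int M` lies in `Int M`. -/
theorem ConnectedIn.subset_interior' {m : ℕ} {K M : Set (Fin m → ℤ)} (hK : ConnectedIn K)
    (hd : Disjoint K M) {x : Fin m → ℤ} (hxK : x ∈ K) (hx : x ∈ interior' M) :
    K ⊆ interior' M := fun y hy =>
  component_subset_interior' hx
    (reflTransGen_step_mono hd.subset_compl_right (hK x hxK y hy))

/-- If the component of `x` in `Kᶜ` avoids `M`, it lies in the component of `x` in `Mᶜ`. -/
theorem component_subset_component {m : ℕ} {K M : Set (Fin m → ℤ)} {x : Fin m → ℤ}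
    (h : Disjoint (component Kᶜ x) M) : component Kᶜ x ⊆ component Mᶜ x := by
  intro y hy
  have hxy : Relation.ReflTransGen (Step Kᶜ) x y := hy
  change Relation.ReflTransGen (Step Mᶜ) x y
  clear hy
  induction hxy with
  | refl => exact .refl
  | tail hab hbc ih =>
    exact ih.tail ⟨hbc.1, Set.disjoint_left.1 h hab, Set.disjoint_left.1 h (hab.tail hbc)⟩

theorem subset_interior'_or_subset_interior' {m : ℕ} (hm : 0 < m) {K M : Set (Fin m → ℤ)}
    (hK : ConnectedIn K) (hM : ConnectedIn M) (hd : Disjoint K M) {x : Fin m → ℤ}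
    (hxK : x ∈ K ∪ interior' K) (hxM : x ∈ M ∪ interior' M) :
    K ⊆ interior' M ∨ M ⊆ interior' K := by
  rcases hxK with hxK | hxK
  · rcases hxM with hxM | hxM
    · exact absurd hxM (Set.disjoint_left.1 hd hxK)
    · exact .inl (hK.subset_interior' hd hxK hxM)
  rcases hxM with hxM | hxM
  · exact .inr (hM.subset_interior' hd.symm hxM hxK)
  by_cases h₁ : Disjoint (component Kᶜ x) M
  · by_cases h₂ : Disjoint (component Mᶜ x) K
    · have heq := (component_subset_component h₁).antisymm (component_subset_component h₂)
      rw [mem_interior'_iff] at hxK hxM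
      obtain ⟨t, hin, hout⟩ :=
        exists_ray_exit hxK.2 Relation.ReflTransGen.refl ⟨0, hm⟩ one_ne_zero
      have hadj := adj_update x ⟨0, hm⟩ (a := x ⟨0, hm⟩ + 1 * t)
        (b := x ⟨0, hm⟩ + 1 * (t + 1 : ℕ)) (by push_cast; ring_nf; norm_num)
      have hzK := mem_of_adj_component hxK.1 hin hout hadj
      rw [heq] at hin hout
      exact absurd (mem_of_adj_component hxM.1 hin hout hadj) (Set.disjoint_left.1 hd hzK)
    · obtain ⟨y, hy, hyK⟩ := Set.not_disjoint_iff.1 h₂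
      exact .inl (hK.subset_interior' hd hyK (component_subset_interior' hxM hy))
  · obtain ⟨y, hy, hyM⟩ := Set.not_disjoint_iff.1 h₁
    exact .inr (hM.subset_interior' hd.symm hyM (component_subset_interior' hxK hy))

/-- A sum of powers of `c` with distinct exponents in `[0, D)` is below `c ^ D / (c - 1)`. -/
theorem sum_zpow_lt {ι : Type*} (s : Finset ι) (f : ι → ℤ) {c : ℝ} (hc : 1 < c) {D : ℤ}
    (h0 : ∀ i ∈ s, 0 ≤ f i) (hD0 : 0 ≤ D) (hD : ∀ i ∈ s, f i < D)
    (hinj : Set.InjOn f s) : ∑ i ∈ s, c ^ f i < c ^ D / (c - 1) := by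
  lift D to ℕ using hD0
  have hle : ∑ i ∈ s, c ^ f i ≤ ∑ k ∈ Finset.range D, c ^ k := by
    have hinj' : Set.InjOn (fun i => (f i).toNat) s := fun i hi j hj hij =>
      hinj hi hj (by have := h0 i hi; have := h0 j hj; simp only at hij; omega)
    calc ∑ i ∈ s, c ^ f i = ∑ i ∈ s, c ^ (f i).toNat := Finset.sum_congr rfl fun i hi => by
          rw [← zpow_natCast, Int.toNat_of_nonneg (h0 i hi)]
      _ = ∑ k ∈ s.image fun i => (f i).toNat, c ^ k := (Finset.sum_image hinj').symm
      _ ≤ _ := by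
        refine Finset.sum_le_sum_of_subset_of_nonneg (fun k hk => ?_) fun _ _ _ => by positivity
        obtain ⟨i, hi, rfl⟩ := Finset.mem_image.1 hk
        have := h0 i hi
        have := hD i hi
        rw [Finset.mem_range]
        omega
  refine hle.trans_lt ?_
  rw [geom_sum_eq hc.ne', zpow_natCast]
  have : 0 < c - 1 := sub_pos.2 hc
  gcongr
  linarith

/-- Lemma 4.5 of the paper: for pairwise distant nonempty finite connected sets
`M_1, …, M_n ⊆ V` that are distant from the complement of `V` and whose interiors lie in
`V`, one has `∑ i (|M_i| + |Int M_i|)·c^{δ(M_i)} < (c^{δ(V)}/(c−1))·|V|`. -/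
theorem contour_counting_lemma (m : ℕ) (hm : 2 ≤ m) (c : ℝ) (hc : 1 < c)
    (V : Set (Fin m → ℤ)) (hVfin : V.Finite) (hVne : V.Nonempty)
    (n : ℕ) (M : Fin n → Set (Fin m → ℤ))
    (hMfin : ∀ i, (M i).Finite) (hMne : ∀ i, (M i).Nonempty)
    (hMconn : ∀ i, ConnectedIn (M i))
    (hMdist : ∀ i j, i ≠ j → Distant (M i) (M j))
    (hMsub : ∀ i, M i ⊆ V)
    (hMfar : ∀ i, Distant (M i) Vᶜ)
    (hMint : ∀ i, interior' (M i) ⊆ V) :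
    ∑ i, (((M i).ncard : ℝ) + ((interior' (M i)).ncard : ℝ)) * c ^ (diam (M i))
      < (c ^ (diam V) / (c - 1)) * (V.ncard : ℝ) := by
  classical
  have hm0 : 0 < m := by omega
  set W : Fin n → Set (Fin m → ℤ) := fun i => M i ∪ interior' (M i) with hW
  have hWV : ∀ i, W i ⊆ V := fun i => Set.union_subset (hMsub i) (hMint i)
  have hcard : ∀ i, ((M i).ncard : ℝ) + ((interior' (M i)).ncard : ℝ) =
      ∑ x ∈ hVfin.toFinset, if x ∈ W i then (1 : ℝ) else 0 := by
    intro i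
    rw [← Nat.cast_add, ← Set.ncard_union_eq (disjoint_interior' (M i)) (hMfin i)
      (hVfin.subset (hMint i)), Finset.sum_boole, ← Set.ncard_coe_finset]
    congr 2
    ext x
    rw [Finset.coe_filter, Set.mem_ofPred_eq, Set.Finite.mem_toFinset]
    exact ⟨fun hx => ⟨hWV i hx, hx⟩, fun hx => hx.2⟩
  have hinj : ∀ x i j, x ∈ W i → x ∈ W j → diam (M i) = diam (M j) → i = j := by
    intro x i j hi hj hij
    by_contra hne
    rcases subset_interior'_or_subset_interior' hm0 (hMconn i) (hMconn j)
      (hMdist i j hne).disjoint hi hj with h | h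
    · exact (diam_lt_of_subset_interior' hm0 (hMfin i) (hMne i) (hMfin j) h).ne hij
    · exact (diam_lt_of_subset_interior' hm0 (hMfin j) (hMne j) (hMfin i) h).ne' hij
  calc ∑ i, (((M i).ncard : ℝ) + ((interior' (M i)).ncard : ℝ)) * c ^ (diam (M i))
      = ∑ x ∈ hVfin.toFinset, ∑ i with x ∈ W i, c ^ (diam (M i)) := by
        simp_rw [hcard, Finset.sum_mul, ite_mul, one_mul, zero_mul]
        rw [Finset.sum_comm]
        simp_rw [Finset.sum_filter]
    _ < ∑ x ∈ hVfin.toFinset, c ^ (diam V) / (c - 1) := by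
        refine Finset.sum_lt_sum_of_nonempty (by simpa using hVne) fun x _ => ?_
        refine sum_zpow_lt _ _ hc (fun i _ => diam_nonneg hm0 (hMfin i) (hMne i))
          (diam_nonneg hm0 hVfin hVne) (fun i _ => diam_lt_of_distant_compl hm0 (hMfin i)
          (hMne i) hVfin (hMsub i) (hMfar i)) fun i hi j hj hij => ?_
        exact hinj x i j (by simpa using hi) (by simpa using hj) hij
    _ = (c ^ (diam V) / (c - 1)) * (V.ncard : ℝ) := by
        rw [Finset.sum_const, nsmul_eq_mul, mul_comm, Set.ncard_eq_toFinset_card V hVfin]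
end

section
/- (Coarse-graining preserves the relative Hamiltonian.) Let S be a finite nonempty type, R ≥ 1 and N ≥ R integers, and φ : (Fin R → S) → ℝ a finite-range potential. Define the block spin space S̃ = (Fin N → S), for a configuration s : ℤ → S its block configuration s̃ : ℤ → S̃ by s̃_k(j) = s(kN + j), and the nearest-neighbour block potential w̄ : S̃ → S̃ → ℝ by w̄(u,v) = ∑_{x=0}^{N−1} φ(j ↦ (u ∨ v)(x + j)), where u ∨ v : Fin 2N → S is the concatenation of u and v. Then for any two configurations s, s' : ℤ → S that are equal outside a finite set, ∑_{y ∈ ℤ} [φ(j ↦ s(y + j)) − φ(j ↦ s'(y + j))] = ∑_{k ∈ ℤ} [w̄(s̃_k, s̃_{k+1}) − w̄(s̃'_k, s̃'_{k+1})], both sums having only finitely many nonzero terms; i.e., the relative Hamiltonian of the original finite-range model equals the relative Hamiltonian of the coarse-grained nearest-neighbour model. -/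
/-- The nearest-neighbour block potential of the coarse-grained model: `w̄(u,v)` collects
all terms `φ(j ↦ (u ∨ v)(x + j))` of the original finite-range model whose window starts in
the left block, where `u ∨ v` is the concatenation of the two block spins `u, v`. -/
noncomputable def blockPot {S : Type*} (R N : ℕ) (hRN : R ≤ N) (φ : (Fin R → S) → ℝ)
    (u v : Fin N → S) : ℝ :=
  ∑ x : Fin N, φ (fun j =>
    if h : x.val + j.val < N then u ⟨x.val + j.val, h⟩
    else v ⟨x.val + j.val - N, by have hx := x.isLt; have hj := j.isLt; omega⟩)

/-- The block potential of two adjacent blocks of `s` is the sum of the window terms that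
start in the left block. -/
theorem blockPot_block {S : Type*} (R N : ℕ) (hRN : R ≤ N) (φ : (Fin R → S) → ℝ)
    (s : ℤ → S) (k : ℤ) :
    blockPot R N hRN φ (fun j => s (k * (N : ℤ) + (j.val : ℤ)))
        (fun j => s ((k + 1) * (N : ℤ) + (j.val : ℤ)))
      = ∑ x : Fin N, φ (fun j => s (k * (N : ℤ) + (x.val : ℤ) + (j.val : ℤ))) := by
  unfold blockPot
  refine Finset.sum_congr rfl fun x _ => congrArg φ (funext fun j => ?_)
  split_ifs with h
  · refine congrArg s ?_
    push_cast
    ring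
  · refine congrArg s ?_
    push_cast [Nat.cast_sub (not_lt.mp h)]
    ring

/-- If two configurations agree outside a finite set, only finitely many windows of a
finite-range potential contribute to their relative Hamiltonian. -/
theorem finite_support_window_sub {S : Type*} (R : ℕ) (φ : (Fin R → S) → ℝ) (s s' : ℤ → S)
    (h : {i : ℤ | s i ≠ s' i}.Finite) :
    (Function.support fun y : ℤ =>
      φ (fun j => s (y + (j.val : ℤ))) - φ (fun j => s' (y + (j.val : ℤ)))).Finite := by
  refine (Set.finite_iUnion fun j : Fin R => h.image fun i => i - (j.val : ℤ)).subset ?_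
  intro y hy
  by_contra hn
  simp only [Set.mem_iUnion, Set.mem_image, not_exists, not_and] at hn
  refine hy (sub_eq_zero.mpr (congrArg φ (funext fun j => ?_)))
  by_contra hne
  exact hn j _ hne (add_sub_cancel_right _ _)

/-- A finitely supported sum over `ℤ` can be computed block by block. -/
theorem finsum_int_eq_finsum_block_sum (N : ℕ) [NeZero N] (f : ℤ → ℝ)
    (hf : f.support.Finite) :
    ∑ᶠ y, f y = ∑ᶠ k : ℤ, ∑ x : Fin N, f (k * (N : ℤ) + (x.val : ℤ)) := by
  let e := (Int.divModEquiv N).symm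
  have he : (fun p => f (e p)).support.Finite := hf.preimage e.injective.injOn
  rw [← finsum_comp_equiv e, finsum_curry _ he]
  refine finsum_congr fun k => ?_
  rw [finsum_eq_sum_of_fintype]
  rfl

/-- Coarse-graining preserves the relative Hamiltonian: for configurations `s, s'` equal
outside a finite set, the relative Hamiltonian of the finite-range model with potential `φ`
equals the relative Hamiltonian of the coarse-grained nearest-neighbour model with block
spin space `Fin N → S`, block configurations `s̃_k = (j ↦ s(kN + j))`, and block potential
`w̄ = blockPot`. -/
theorem coarse_graining_preserves_relative_hamiltonian
    {S : Type*} [Fintype S] [Nonempty S] (R N : ℕ) (hR : 1 ≤ R) (hRN : R ≤ N)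
    (φ : (Fin R → S) → ℝ) (s s' : ℤ → S) (h : {i : ℤ | s i ≠ s' i}.Finite) :
    ∑ᶠ y : ℤ, (φ (fun j => s (y + (j.val : ℤ))) - φ (fun j => s' (y + (j.val : ℤ))))
      = ∑ᶠ k : ℤ,
          (blockPot R N hRN φ (fun j => s (k * (N : ℤ) + (j.val : ℤ)))
              (fun j => s ((k + 1) * (N : ℤ) + (j.val : ℤ)))
            - blockPot R N hRN φ (fun j => s' (k * (N : ℤ) + (j.val : ℤ)))
              (fun j => s' ((k + 1) * (N : ℤ) + (j.val : ℤ)))) := by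
  have : NeZero N := ⟨by omega⟩
  rw [finsum_int_eq_finsum_block_sum N _ (finite_support_window_sub R φ s s' h)]
  refine finsum_congr fun k => ?_
  rw [blockPot_block, blockPot_block, Finset.sum_sub_distrib]
end
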